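/- arXiv:2510.17707 — 4 statements merged into one kernel-verified Lean document; each statement's English description precedes it below -/
import Mathlib

section
/- For all integers p ≥ q ≥ 3, there exists a presentation of B(p,q) with exactly β1(p,q) generators and exactly β2(p,q) relators in which every relator is a commutator; precisely, there exists a family r : Fin β2(p,q) → FreeGroup (Fin β1(p,q)) such that for every k there exist elements x, y of the free group FreeGroup (Fin β1(p,q)) with r k = x*y*x⁻¹*y⁻¹, and the presented group with generators Fin β1(p,q) and relators {r k} is isomorphic to B(p,q). -/
/-- Generators of the presentation of `B(p,q)`: triples `(t, ℓ, i)` with `t ∈ Fin 3`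
(`t = 0` for `a`, `t = 1` for `b`, `t = 2` for `c`), `1 ≤ ℓ ≤ q - 1`, `1 ≤ i ≤ p - 1`. -/
def BGen (p q : ℕ) : Type :=
  {x : Fin 3 × ℕ × ℕ // 1 ≤ x.2.1 ∧ x.2.1 ≤ q - 1 ∧ 1 ≤ x.2.2 ∧ x.2.2 ≤ p - 1}

/-- The generator `a_{ℓ,i}` (as an element of the free group), or `1` if out of range. -/
def ga (p q ℓ i : ℕ) : FreeGroup (BGen p q) :=
  if h : 1 ≤ ℓ ∧ ℓ ≤ q - 1 ∧ 1 ≤ i ∧ i ≤ p - 1 then FreeGroup.of ⟨(0, ℓ, i), h⟩ else 1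

/-- The generator `b_{ℓ,i}`, or `1` if out of range. -/
def gb (p q ℓ i : ℕ) : FreeGroup (BGen p q) :=
  if h : 1 ≤ ℓ ∧ ℓ ≤ q - 1 ∧ 1 ≤ i ∧ i ≤ p - 1 then FreeGroup.of ⟨(1, ℓ, i), h⟩ else 1

/-- The generator `c_{ℓ,i}`, or `1` if out of range. -/
def gc (p q ℓ i : ℕ) : FreeGroup (BGen p q) :=
  if h : 1 ≤ ℓ ∧ ℓ ≤ q - 1 ∧ 1 ≤ i ∧ i ≤ p - 1 then FreeGroup.of ⟨(2, ℓ, i), h⟩ else 1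

/-- The commutator `[x, y] = x * y * x⁻¹ * y⁻¹`. -/
def gcomm {G : Type*} [Group G] (x y : G) : G := x * y * x⁻¹ * y⁻¹

/-- The relators (R1)–(R5) of the presentation of `B(p,q)`. -/
def Brels (p q : ℕ) : Set (FreeGroup (BGen p q)) :=
  {r | r = ga p q 1 1 ∨ r = gc p q (q - 1) 1
    ∨ (∃ ℓ i j, 1 ≤ ℓ ∧ ℓ ≤ q - 1 ∧ 1 ≤ i ∧ i < j ∧ j ≤ p - 1 ∧
        r = gb p q ℓ i * ga p q ℓ j * (gb p q ℓ i)⁻¹ * (gc p q ℓ j)⁻¹)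
    ∨ (∃ ℓ i j, 1 ≤ ℓ ∧ ℓ ≤ q - 2 ∧ 1 ≤ i ∧ i ≤ p - 1 ∧ 1 ≤ j ∧ j ≤ p - i ∧
        r = gc p q ℓ i * ga p q (ℓ + 1) j * (gb p q ℓ i)⁻¹ * (gb p q (ℓ + 1) j)⁻¹)
    ∨ (∃ ℓ i j, 1 ≤ ℓ ∧ ℓ ≤ q - 2 ∧ 3 ≤ i ∧ i ≤ p - 1 ∧ 3 ≤ j ∧ j ≤ p - 1 ∧ p + 2 ≤ i + j ∧
        r = gcomm (gc p q ℓ i) (ga p q (ℓ + 1) j))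
    ∨ (∃ ℓ lam i j, 2 ≤ ℓ + 1 ∧ ℓ + 1 < lam ∧ lam ≤ q - 1 ∧
        1 ≤ i ∧ i ≤ p - 1 ∧ 1 ≤ j ∧ j ≤ p - 1 ∧
        r = gcomm (gc p q ℓ i) (ga p q lam j))}

/-- The square-section braid group `B(p,q) = B_{pq-2}(p × q)`, via its presentation. -/
abbrev B (p q : ℕ) : Type := PresentedGroup (Brels p q)

/-- `β₁(p,q) = (p-1)(q-1) + 1`, the first Betti number of `UC(pq-2, p×q)`. -/
def beta1 (p q : ℕ) : ℕ := (p - 1) * (q - 1) + 1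

/-- `β₂(p,q) = ((p²+1)(q²+1) - pq(2p+2q+3) + 7(p+q-1))/2`, the second Betti number of
`UC(pq-2, p×q)`; a nonnegative integer for `p ≥ q ≥ 3`. -/
def beta2 (p q : ℕ) : ℕ :=
  (((((p : ℤ) ^ 2 + 1) * ((q : ℤ) ^ 2 + 1) - (p : ℤ) * q * (2 * p + 2 * q + 3)
      + 7 * ((p : ℤ) + q - 1)) / 2)).toNat

namespace SquareBraid

/-! ### Words in the reduced generators -/

section Words

variable {H H' : Type*} [Group H] [Group H']

/-- The word for `a_{k+2,1}` in the `b_{ℓ,i}` and `x = a_{2,1}`. -/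
def firstA (b : ℕ → ℕ → H) (x : H) : ℕ → H
  | 0 => x
  | k + 1 => b (k + 2) 1 *
      (firstA b x k * (b (k + 1) 1)⁻¹ * (b (k + 2) 1)⁻¹ * b (k + 2) 2 * b (k + 1) 1)⁻¹ *
      (b (k + 2) 1)⁻¹ * b (k + 3) 1 * b (k + 2) 2

/-- The word for `a_{ℓ,j}`. -/
def wordA (b : ℕ → ℕ → H) (x : H) (ℓ j : ℕ) : H :=
  if ℓ = 1 then
    if j = 1 then 1 else (b 1 1)⁻¹ * (b 2 1 * b 1 j * x⁻¹) * b 1 1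
  else firstA b x (ℓ - 2) * (b (ℓ - 1) 1)⁻¹ * (b ℓ 1)⁻¹ * b ℓ j * b (ℓ - 1) 1

/-- The word for `c_{ℓ,j}`, where `m` is the number of rows. -/
def wordC (m : ℕ) (b : ℕ → ℕ → H) (x : H) (ℓ j : ℕ) : H :=
  if ℓ = m then
    if j = 1 then 1 else b m 1 * wordA b x m j * (b m 1)⁻¹
  else b (ℓ + 1) 1 * b ℓ j * (firstA b x (ℓ - 1))⁻¹

lemma map_firstA (f : H →* H') (b : ℕ → ℕ → H) (x : H) (k : ℕ) :
    f (firstA b x k) = firstA (fun ℓ i => f (b ℓ i)) (f x) k := by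
  induction k with
  | zero => rfl
  | succ k ih => simp [firstA, ih]

lemma map_wordA (f : H →* H') (b : ℕ → ℕ → H) (x : H) (ℓ j : ℕ) :
    f (wordA b x ℓ j) = wordA (fun ℓ i => f (b ℓ i)) (f x) ℓ j := by
  unfold wordA
  split_ifs <;> simp [map_firstA]

lemma map_wordC (f : H →* H') (m : ℕ) (b : ℕ → ℕ → H) (x : H) (ℓ j : ℕ) :
    f (wordC m b x ℓ j) = wordC m (fun ℓ i => f (b ℓ i)) (f x) ℓ j := by
  unfold wordC
  split_ifs <;> simp [map_firstA, map_wordA]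

lemma wordA_one_one (b : ℕ → ℕ → H) (x : H) : wordA b x 1 1 = 1 := by simp [wordA]

lemma wordA_one {m : ℕ} (hm : 2 ≤ m) (b : ℕ → ℕ → H) (x : H) {j : ℕ} (hj : 2 ≤ j) :
    wordA b x 1 j = (b 1 1)⁻¹ * wordC m b x 1 j * b 1 1 := by
  have h1 : j ≠ 1 := by omega
  have h2 : 1 ≠ m := by omega
  simp [wordA, wordC, h1, h2, firstA]

lemma wordC_last_one (m : ℕ) (b : ℕ → ℕ → H) (x : H) : wordC m b x m 1 = 1 := by simp [wordC]

lemma wordC_last (m : ℕ) (b : ℕ → ℕ → H) (x : H) {j : ℕ} (hj : 2 ≤ j) :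
    wordC m b x m j = b m 1 * wordA b x m j * (b m 1)⁻¹ := by
  have h1 : j ≠ 1 := by omega
  simp [wordC, h1]

lemma wordA_add_two (b : ℕ → ℕ → H) (x : H) (k j : ℕ) :
    wordA b x (k + 2) j =
      firstA b x k * (b (k + 1) 1)⁻¹ * (b (k + 2) 1)⁻¹ * b (k + 2) j * b (k + 1) 1 := by
  simp [wordA]

lemma wordC_add_one {m : ℕ} (b : ℕ → ℕ → H) (x : H) {k : ℕ} (hk : k + 1 < m) (j : ℕ) :
    wordC m b x (k + 1) j = b (k + 2) 1 * b (k + 1) j * (firstA b x k)⁻¹ := by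
  have h : k + 1 ≠ m := by omega
  simp [wordC, h]

lemma firstA_succ (b : ℕ → ℕ → H) (x : H) (k : ℕ) :
    firstA b x (k + 1) = b (k + 2) 1 * (wordA b x (k + 2) 2)⁻¹ * (b (k + 2) 1)⁻¹ *
      b (k + 3) 1 * b (k + 2) 2 := by
  rw [wordA_add_two]; rfl

end Words

/-! ### The two systems of relations -/

section Relations

variable {H : Type*} [Group H]

/-- The relations (R1)–(R5) for a family of elements of a group, with `m` rows of length `n`. -/
structure BraidRelations (m n : ℕ) (a b c : ℕ → ℕ → H) : Prop where
  a_one : a 1 1 = 1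
  c_last : c m 1 = 1
  conj : ∀ ℓ i j, 1 ≤ ℓ → ℓ ≤ m → 1 ≤ i → i < j → j ≤ n → b ℓ i * a ℓ j * (b ℓ i)⁻¹ = c ℓ j
  square : ∀ ℓ i j, 1 ≤ ℓ → ℓ + 1 ≤ m → 1 ≤ i → 1 ≤ j → i + j ≤ n + 1 →
    c ℓ i * a (ℓ + 1) j = b (ℓ + 1) j * b ℓ i
  comm_next : ∀ ℓ i j, 1 ≤ ℓ → ℓ + 1 ≤ m → 3 ≤ i → i ≤ n → 3 ≤ j → j ≤ n → n + 3 ≤ i + j →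
    Commute (c ℓ i) (a (ℓ + 1) j)
  comm_far : ∀ ℓ k i j, 1 ≤ ℓ → ℓ + 1 < k → k ≤ m → 1 ≤ i → i ≤ n → 1 ≤ j → j ≤ n →
    Commute (c ℓ i) (a k j)

/-- The commutation relations between words in the `b_{ℓ,i}` and `x = a_{2,1}`. -/
structure CommutatorRelations (m n : ℕ) (b : ℕ → ℕ → H) (x : H) : Prop where
  conj : ∀ ℓ i j, 1 ≤ ℓ → ℓ ≤ m → 2 ≤ i → i < j → j ≤ n →
    Commute ((b ℓ 1)⁻¹ * b ℓ i) (wordA b x ℓ j)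
  square : ∀ ℓ i j, 1 ≤ ℓ → ℓ + 1 ≤ m → 2 ≤ i → 2 ≤ j → i + j ≤ n + 1 →
    Commute (b ℓ i * (b ℓ 1)⁻¹) ((b (ℓ + 1) 1)⁻¹ * b (ℓ + 1) j)
  comm_next : ∀ ℓ i j, 1 ≤ ℓ → ℓ + 1 ≤ m → 3 ≤ i → i ≤ n → 3 ≤ j → j ≤ n → n + 3 ≤ i + j →
    Commute (wordC m b x ℓ i) (wordA b x (ℓ + 1) j)
  middle : ∀ ℓ j, 1 ≤ ℓ → ℓ + 2 ≤ m → 3 ≤ j → j ≤ n →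
    Commute (b (ℓ + 1) j * (b (ℓ + 1) 2)⁻¹)
      ((b (ℓ + 2) 1)⁻¹ * b (ℓ + 1) 1 * (wordC m b x ℓ 1)⁻¹)
  comm_far : ∀ ℓ k i j, 1 ≤ ℓ → ℓ + 1 < k → k ≤ m → 1 ≤ i → i ≤ n → 1 ≤ j → j ≤ n →
    Commute (wordC m b x ℓ i) (wordA b x k j)

variable {m n : ℕ} {a b c : ℕ → ℕ → H}

lemma square_relation_iff (b₁ b b₁' b' x : H) :
    b₁' * b * x⁻¹ * (x * b₁⁻¹ * b₁'⁻¹ * b' * b₁) = b' * b ↔ Commute (b * b₁⁻¹) (b₁'⁻¹ * b') := by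
  have e1 : b * b₁⁻¹ * (b₁'⁻¹ * b') =
      b₁'⁻¹ * (b₁' * b * x⁻¹ * (x * b₁⁻¹ * b₁'⁻¹ * b' * b₁)) * b₁⁻¹ := by group
  have e2 : b₁'⁻¹ * b' * (b * b₁⁻¹) = b₁'⁻¹ * (b' * b) * b₁⁻¹ := by group
  rw [Commute, SemiconjBy, e1, e2, mul_left_inj, mul_right_inj]

lemma conj_relation_iff {b₁ a c : H} (h : b₁ * a * b₁⁻¹ = c) (b : H) :
    b * a * b⁻¹ = c ↔ Commute (b₁⁻¹ * b) a := by
  have e1 : b₁⁻¹ * b * a = b₁⁻¹ * (b * a * b⁻¹) * b := by group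
  have e2 : a * (b₁⁻¹ * b) = b₁⁻¹ * (b₁ * a * b₁⁻¹) * b := by group
  rw [Commute, SemiconjBy, e1, e2, mul_left_inj, mul_right_inj, h]

lemma middle_relation_iff {b₁ b₂ b₁' x y z : H}
    (h : b₁ * (y⁻¹ * b₂ * z) * b₁⁻¹ = b₁' * b₂ * x⁻¹) (b : H) :
    b₁ * (y⁻¹ * b * z) * b₁⁻¹ = b₁' * b * x⁻¹ ↔
      Commute (b * b₂⁻¹) (b₁'⁻¹ * b₁ * y⁻¹) := by
  have e0 : x⁻¹ = b₂⁻¹ * b₁'⁻¹ * (b₁ * (y⁻¹ * b₂ * z) * b₁⁻¹) := by rw [h]; group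
  have e1 : b * b₂⁻¹ * (b₁'⁻¹ * b₁ * y⁻¹) =
      b₁'⁻¹ * (b₁' * b * x⁻¹) * (b₁ * z⁻¹ * b₂⁻¹) := by rw [e0]; group
  have e2 : b₁'⁻¹ * b₁ * y⁻¹ * (b * b₂⁻¹) =
      b₁'⁻¹ * (b₁ * (y⁻¹ * b * z) * b₁⁻¹) * (b₁ * z⁻¹ * b₂⁻¹) := by group
  rw [Commute, SemiconjBy, e1, e2, mul_left_inj, mul_right_inj, eq_comm]

lemma wordA_next {m : ℕ} (b : ℕ → ℕ → H) (x : H) {k : ℕ} (hk : k + 1 < m) (j : ℕ) :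
    wordA b x (k + 2) j = (wordC m b x (k + 1) 1)⁻¹ * b (k + 2) j * b (k + 1) 1 := by
  rw [wordA_add_two, wordC_add_one _ _ hk]; group

lemma conj_wordA_two {m : ℕ} (b : ℕ → ℕ → H) (x : H) {k : ℕ} (hk : k + 2 < m) :
    b (k + 2) 1 * wordA b x (k + 2) 2 * (b (k + 2) 1)⁻¹ = wordC m b x (k + 2) 2 := by
  rw [wordC_add_one _ _ hk, firstA_succ]; group

lemma BraidRelations.a_first (h : BraidRelations m n a b c) (hn : 2 ≤ n) (k : ℕ)
    (hk : k + 2 ≤ m) : a (k + 2) 1 = firstA b (a 2 1) k := by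
  induction k with
  | zero => rfl
  | succ k ih =>
    have e0 := ih (by omega)
    have e1 := h.square (k + 1) 1 1 (by omega) (by omega) le_rfl le_rfl (by omega)
    have e2 := h.square (k + 1) 1 2 (by omega) (by omega) le_rfl (by omega) (by omega)
    have e3 := h.square (k + 2) 2 1 (by omega) (by omega) (by omega) le_rfl (by omega)
    have e4 := h.conj (k + 2) 1 2 (by omega) (by omega) le_rfl (by omega) hn
    have e5 : a (k + 2) 2 = wordA b (a 2 1) (k + 2) 2 := by
      rw [wordA_add_two, ← e0]
      rw [← eq_mul_inv_iff_mul_eq] at e1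
      rw [e1, ← eq_inv_mul_iff_mul_eq] at e2
      rw [e2]; group
    rw [firstA_succ, ← e5]
    rw [← e4, ← eq_inv_mul_iff_mul_eq] at e3
    rw [e3]; group

lemma BraidRelations.a_eq_wordA (h : BraidRelations m n a b c) (hn : 2 ≤ n) (hm : 2 ≤ m) {ℓ j : ℕ}
    (h1 : 1 ≤ ℓ) (h2 : ℓ ≤ m) (h3 : 1 ≤ j) (h4 : j ≤ n) : a ℓ j = wordA b (a 2 1) ℓ j := by
  obtain ⟨k, rfl⟩ | rfl : (∃ k, ℓ = k + 2) ∨ ℓ = 1 := by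
    rcases Nat.lt_or_ge ℓ 2 with h | h
    · right; omega
    · left; exact ⟨ℓ - 2, by omega⟩
  · have e1 := h.square (k + 1) 1 1 (by omega) (by omega) le_rfl le_rfl (by omega)
    have e2 := h.square (k + 1) 1 j (by omega) (by omega) le_rfl (by omega) (by omega)
    rw [wordA_add_two, ← h.a_first hn k h2]
    rw [← eq_mul_inv_iff_mul_eq] at e1
    rw [e1, ← eq_inv_mul_iff_mul_eq] at e2
    rw [e2]; group
  · rcases h3.eq_or_lt with rfl | h3
    · rw [h.a_one, wordA_one_one]
    · have e1 := h.conj 1 1 j le_rfl h2 le_rfl h3 h4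
      have e2 := h.square 1 j 1 le_rfl (by omega) (by omega) le_rfl (by omega)
      have h5 : j ≠ 1 := by omega
      rw [← eq_mul_inv_iff_mul_eq] at e2
      simp only [wordA, if_true, if_neg h5]
      rw [e2] at e1
      rw [← e1]; group

lemma BraidRelations.c_eq_wordC (h : BraidRelations m n a b c) (hn : 2 ≤ n) (hm : 2 ≤ m) {ℓ j : ℕ}
    (h1 : 1 ≤ ℓ) (h2 : ℓ ≤ m) (h3 : 1 ≤ j) (h4 : j ≤ n) : c ℓ j = wordC m b (a 2 1) ℓ j := by
  rcases h2.eq_or_lt with rfl | h2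
  · rcases h3.eq_or_lt with rfl | h3
    · rw [h.c_last, wordC_last_one]
    · rw [wordC_last _ _ _ h3, ← h.a_eq_wordA hn hm h1 le_rfl (by omega) h4,
        h.conj _ 1 j h1 le_rfl le_rfl h3 h4]
  · obtain ⟨k, rfl⟩ : ∃ k, ℓ = k + 1 := ⟨ℓ - 1, by omega⟩
    have e2 := h.square (k + 1) j 1 (by omega) (by omega) (by omega) le_rfl (by omega)
    rw [wordC_add_one _ _ h2, ← h.a_first hn k h2, ← e2]; group

lemma BraidRelations.commutatorRelations (h : BraidRelations m n a b c) (hn : 2 ≤ n) (hm : 2 ≤ m) :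
    CommutatorRelations m n b (a 2 1) where
  conj ℓ i j h1 h2 h3 h4 h5 := by
    rw [← h.a_eq_wordA hn hm h1 h2 (by omega) h5]
    exact (conj_relation_iff (h.conj ℓ 1 j h1 h2 le_rfl (by omega) h5) _).1
      (h.conj ℓ i j h1 h2 (by omega) h4 h5)
  square ℓ i j h1 h2 h3 h4 h5 := by
    have e := h.square ℓ i j h1 h2 (by omega) (by omega) h5
    obtain ⟨k, rfl⟩ : ∃ k, ℓ = k + 1 := ⟨ℓ - 1, by omega⟩
    rw [h.a_eq_wordA hn hm (by omega) h2 (by omega) (by omega),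
      h.c_eq_wordC hn hm h1 (by omega) (by omega) (by omega),
      wordA_add_two, wordC_add_one _ _ (by omega)] at e
    exact (square_relation_iff _ _ _ _ _).1 e
  comm_next ℓ i j h1 h2 h3 h4 h5 h6 h7 := by
    rw [← h.a_eq_wordA hn hm (by omega) h2 (by omega) h6,
      ← h.c_eq_wordC hn hm h1 (by omega) (by omega) h4]
    exact h.comm_next ℓ i j h1 h2 h3 h4 h5 h6 h7
  middle ℓ j h1 h2 h3 h4 := by
    have e := h.conj (ℓ + 1) 1 j (by omega) (by omega) le_rfl (by omega) h4
    obtain ⟨k, rfl⟩ : ∃ k, ℓ = k + 1 := ⟨ℓ - 1, by omega⟩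
    have e' := conj_wordA_two b (a 2 1) h2
    rw [h.a_eq_wordA hn hm (by omega) (by omega) (by omega) h4,
      h.c_eq_wordC hn hm (by omega) (by omega) (by omega) h4,
      wordA_next (m := m) _ _ (by omega), wordC_add_one (k := k + 1) _ _ (by omega)] at e
    rw [wordA_next (m := m) _ _ (by omega), wordC_add_one (k := k + 1) _ _ (by omega)] at e'
    exact (middle_relation_iff e' _).1 e
  comm_far ℓ k i j h1 h2 h3 h4 h5 h6 h7 := by
    rw [← h.a_eq_wordA hn hm (by omega) h3 (by omega) h7,
      ← h.c_eq_wordC hn hm h1 (by omega) (by omega) h5]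
    exact h.comm_far ℓ k i j h1 h2 h3 h4 h5 h6 h7

lemma CommutatorRelations.conj_one {x : H} (h : CommutatorRelations m n b x) (hm : 2 ≤ m)
    {ℓ j : ℕ} (h1 : 1 ≤ ℓ) (h2 : ℓ ≤ m) (h3 : 2 ≤ j) (h4 : j ≤ n) :
    b ℓ 1 * wordA b x ℓ j * (b ℓ 1)⁻¹ = wordC m b x ℓ j := by
  rcases h2.eq_or_lt with rfl | h2
  · rw [wordC_last _ _ _ h3]
  rcases h1.eq_or_lt with rfl | h1
  · rw [wordA_one hm b x h3]; group
  obtain ⟨k, rfl⟩ : ∃ k, ℓ = k + 2 := ⟨ℓ - 2, by omega⟩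
  have e := conj_wordA_two b x h2
  rcases h3.eq_or_lt with rfl | h3
  · exact e
  rw [wordA_next (m := m) _ _ (by omega), wordC_add_one (k := k + 1) _ _ (by omega)] at e ⊢
  exact (middle_relation_iff e _).2 (h.middle (k + 1) j (by omega) h2 h3 h4)

lemma CommutatorRelations.braidRelations {x : H} (h : CommutatorRelations m n b x)
    (hm : 2 ≤ m) :
    BraidRelations m n (wordA b x) b (wordC m b x) where
  a_one := wordA_one_one b x
  c_last := wordC_last_one m b x
  conj ℓ i j h1 h2 h3 h4 h5 := by
    have e := h.conj_one hm h1 h2 (show 2 ≤ j by omega) h5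
    rcases h3.eq_or_lt with rfl | h3
    · exact e
    · exact (conj_relation_iff e _).2 (h.conj ℓ i j h1 h2 h3 h4 h5)
  square ℓ i j h1 h2 h3 h4 h5 := by
    obtain ⟨k, rfl⟩ : ∃ k, ℓ = k + 1 := ⟨ℓ - 1, by omega⟩
    rw [wordA_add_two, wordC_add_one _ _ (by omega), square_relation_iff]
    rcases h3.eq_or_lt with rfl | h3
    · simp
    rcases h4.eq_or_lt with rfl | h4
    · simp
    exact h.square (k + 1) i j h1 h2 h3 h4 h5
  comm_next := h.comm_next
  comm_far := h.comm_far

end Relations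

/-! ### The commutator presentation -/

/-- Pairs `i < j` in `Fin k`, with `j` as the first component. -/
abbrev Triangle (k : ℕ) : Type := Σ j : Fin k, Fin j

lemma two_mul_card_triangle (k : ℕ) : 2 * Fintype.card (Triangle k) = k * (k - 1) := by
  rw [Fintype.card_sigma]
  simp only [Fintype.card_fin]
  rw [Fin.sum_univ_eq_sum_range (fun i => i), mul_comm, Finset.sum_range_id_mul_two]

/-- Index type of the commutator relators, for `M + 2` rows of length `N + 2`. -/
abbrev RelatorIndex (M N : ℕ) : Type :=
  (Fin (M + 2) × Triangle (N + 1)) ⊕ (Fin (M + 1) × Triangle (N + 1)) ⊕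
    (Fin (M + 1) × Triangle (N + 1)) ⊕ (Fin M × Fin N) ⊕
    (Triangle (M + 1) × Fin (N + 2) × Fin (N + 2))

lemma card_relatorIndex (M N : ℕ) :
    Fintype.card (RelatorIndex M N) = beta2 (N + 3) (M + 3) := by
  have h1 := two_mul_card_triangle (N + 1)
  have h2 := two_mul_card_triangle (M + 1)
  simp only [Fintype.card_sum, Fintype.card_prod, Fintype.card_fin, beta2]
  generalize Fintype.card (Triangle (N + 1)) = s at *
  generalize Fintype.card (Triangle (M + 1)) = t at *
  rw [Nat.add_sub_cancel] at h1 h2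
  zify at h1 h2
  refine (Int.toNat_natCast _).symm.trans (congrArg Int.toNat (Eq.symm ?_))
  apply Int.ediv_eq_of_eq_mul_right two_ne_zero
  push_cast
  linear_combination (-(3 * (M : ℤ) + 4)) * h1 - ((N : ℤ) + 2) ^ 2 * h2

section Relators

variable {H H' : Type*} [Group H] [Group H']

/-- The two words whose commutator is the relator with a given index. -/
def commutingPair (M N : ℕ) (b : ℕ → ℕ → H) (x : H) : RelatorIndex M N → H × H
  | .inl (ℓ, ⟨j, i⟩) =>
    ((b (ℓ + 1) 1)⁻¹ * b (ℓ + 1) (i + 2), wordA b x (ℓ + 1) (j + 2))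
  | .inr (.inl (ℓ, ⟨j, i⟩)) =>
    (b (ℓ + 1) (i + 2) * (b (ℓ + 1) 1)⁻¹, (b (ℓ + 2) 1)⁻¹ * b (ℓ + 2) (j - i + 1))
  | .inr (.inr (.inl (ℓ, ⟨j, i⟩))) =>
    (wordC (M + 2) b x (ℓ + 1) (N + 2 - i), wordA b x (ℓ + 2) (j + 2))
  | .inr (.inr (.inr (.inl (ℓ, j)))) =>
    (b (ℓ + 2) (j + 3) * (b (ℓ + 2) 2)⁻¹,
      (b (ℓ + 3) 1)⁻¹ * b (ℓ + 2) 1 * (wordC (M + 2) b x (ℓ + 1) 1)⁻¹)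
  | .inr (.inr (.inr (.inr (⟨k, ℓ⟩, i, j)))) =>
    (wordC (M + 2) b x (ℓ + 1) (i + 1), wordA b x (k + 2) (j + 1))

lemma map_commutingPair (f : H →* H') (M N : ℕ) (b : ℕ → ℕ → H) (x : H) (k : RelatorIndex M N) :
    commutingPair M N (fun ℓ i => f (b ℓ i)) (f x) k =
      (f (commutingPair M N b x k).1, f (commutingPair M N b x k).2) := by
  rcases k with ⟨ℓ, j, i⟩ | ⟨ℓ, j, i⟩ | ⟨ℓ, j, i⟩ | ⟨ℓ, j⟩ | ⟨⟨k, ℓ⟩, i, j⟩ <;>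
    simp [commutingPair, map_wordA, map_wordC]

lemma commutatorRelations_iff (M N : ℕ) (b : ℕ → ℕ → H) (x : H) :
    CommutatorRelations (M + 2) (N + 2) b x ↔
      ∀ k, Commute (commutingPair M N b x k).1 (commutingPair M N b x k).2 := by
  constructor
  · rintro h (⟨ℓ, j, i⟩ | ⟨ℓ, j, i⟩ | ⟨ℓ, j, i⟩ | ⟨ℓ, j⟩ | ⟨⟨k, ℓ⟩, i, j⟩)
    · exact h.conj _ _ _ (by omega) (by omega) (by omega) (by omega) (by omega)
    · exact h.square _ _ _ (by omega) (by omega) (by omega) (by omega) (by omega)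
    · have hi : (i : ℕ) < j := i.isLt
      have hj := j.isLt
      exact h.comm_next (ℓ + 1) (N + 2 - i) (j + 2) (by omega) (by omega) (by omega) (by omega)
        (by omega) (by omega) (by omega)
    · exact h.middle (ℓ + 1) (j + 3) (by omega) (by omega) (by omega) (by omega)
    · have hℓ : (ℓ : ℕ) < k := ℓ.isLt
      have hk := k.isLt
      exact h.comm_far (ℓ + 1) (k + 2) (i + 1) (j + 1) (by omega) (by omega) (by omega)
        (by omega) (by omega) (by omega) (by omega)
  · intro h
    constructor
    · intro ℓ i j h1 h2 h3 h4 h5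
      obtain ⟨ℓ, rfl⟩ := Nat.exists_eq_add_of_le' h1
      obtain ⟨i, rfl⟩ := Nat.exists_eq_add_of_le' h3
      obtain ⟨j, rfl⟩ := Nat.exists_eq_add_of_le' (show 2 ≤ j by omega)
      exact h (.inl (⟨ℓ, by omega⟩, ⟨⟨j, by omega⟩, ⟨i, by simpa using h4⟩⟩))
    · intro ℓ i j h1 h2 h3 h4 h5
      obtain ⟨ℓ, rfl⟩ := Nat.exists_eq_add_of_le' h1
      obtain ⟨i, rfl⟩ := Nat.exists_eq_add_of_le' h3
      obtain ⟨j, rfl⟩ := Nat.exists_eq_add_of_le' h4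
      have e := h (.inr (.inl (⟨ℓ, by omega⟩,
        ⟨⟨i + j + 1, by omega⟩, ⟨i, by simp only; omega⟩⟩)))
      have e' : i + j + 1 - i + 1 = j + 2 := by omega
      simpa only [commutingPair, e'] using e
    · intro ℓ i j h1 h2 h3 h4 h5 h6 h7
      obtain ⟨ℓ, rfl⟩ := Nat.exists_eq_add_of_le' h1
      obtain ⟨j, rfl⟩ := Nat.exists_eq_add_of_le' (show 2 ≤ j by omega)
      have e := h (.inr (.inr (.inl (⟨ℓ, by omega⟩,
        ⟨⟨j, by omega⟩, ⟨N + 2 - i, by simp only; omega⟩⟩))))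
      have e' : N + 2 - (N + 2 - i) = i := by omega
      simpa only [commutingPair, e'] using e
    · intro ℓ j h1 h2 h3 h4
      obtain ⟨ℓ, rfl⟩ := Nat.exists_eq_add_of_le' h1
      obtain ⟨j, rfl⟩ := Nat.exists_eq_add_of_le' h3
      exact h (.inr (.inr (.inr (.inl (⟨ℓ, by omega⟩, ⟨j, by omega⟩)))))
    · intro ℓ k i j h1 h2 h3 h4 h5 h6 h7
      obtain ⟨ℓ, rfl⟩ := Nat.exists_eq_add_of_le' h1
      obtain ⟨k, rfl⟩ := Nat.exists_eq_add_of_le' (show 2 ≤ k by omega)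
      obtain ⟨i, rfl⟩ := Nat.exists_eq_add_of_le' h4
      obtain ⟨j, rfl⟩ := Nat.exists_eq_add_of_le' h6
      exact h (.inr (.inr (.inr (.inr
        (⟨⟨k, by omega⟩, ⟨ℓ, by simp only; omega⟩⟩, ⟨i, by omega⟩, ⟨j, by omega⟩)))))

end Relators

/-- The reduced generators: `none` for `a_{2,1}` and `some (ℓ, i)` for `b_{ℓ+1,i+1}`. -/
abbrev ReducedGen (M N : ℕ) : Type := Option (Fin (M + 2) × Fin (N + 2))

lemma card_reducedGen (M N : ℕ) :
    Fintype.card (ReducedGen M N) = beta1 (N + 3) (M + 3) := by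
  simp [beta1, mul_comm]

/-- The reduced generator `b_{ℓ,i}`, or `1` if out of range. -/
def reducedB (M N ℓ i : ℕ) : FreeGroup (ReducedGen M N) :=
  if h : 1 ≤ ℓ ∧ ℓ ≤ M + 2 ∧ 1 ≤ i ∧ i ≤ N + 2 then
    FreeGroup.of (some (⟨ℓ - 1, by omega⟩, ⟨i - 1, by omega⟩))
  else 1

/-- The relators of the commutator presentation. -/
def relator (M N : ℕ) (k : RelatorIndex M N) : FreeGroup (ReducedGen M N) :=
  let w := commutingPair M N (reducedB M N) (FreeGroup.of none) k
  w.1 * w.2 * w.1⁻¹ * w.2⁻¹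

lemma commutatorRelations_reduced (M N : ℕ) :
    CommutatorRelations (M + 2) (N + 2)
      (fun ℓ i => PresentedGroup.mk (Set.range (relator M N)) (reducedB M N ℓ i))
      (PresentedGroup.mk (Set.range (relator M N)) (FreeGroup.of none)) := by
  rw [commutatorRelations_iff]
  intro k
  rw [map_commutingPair, commute_iff_eq, ← mul_inv_eq_one, mul_inv_rev, ← mul_assoc]
  simpa [relator] using PresentedGroup.one_of_mem (Set.mem_range_self (f := relator M N) k)

lemma braidRelations_B (M N : ℕ) :
    BraidRelations (M + 2) (N + 2)
      (fun ℓ i => PresentedGroup.mk (Brels (N + 3) (M + 3)) (ga (N + 3) (M + 3) ℓ i))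
      (fun ℓ i => PresentedGroup.mk (Brels (N + 3) (M + 3)) (gb (N + 3) (M + 3) ℓ i))
      (fun ℓ i => PresentedGroup.mk (Brels (N + 3) (M + 3)) (gc (N + 3) (M + 3) ℓ i)) where
  a_one := PresentedGroup.one_of_mem (Or.inl rfl)
  c_last := PresentedGroup.one_of_mem (Or.inr (Or.inl rfl))
  conj ℓ i j h1 h2 h3 h4 h5 := by
    rw [← mul_inv_eq_one]
    exact PresentedGroup.one_of_mem (Or.inr (Or.inr (Or.inl
      ⟨ℓ, i, j, h1, h2, h3, h4, h5, rfl⟩)))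
  square ℓ i j h1 h2 h3 h4 h5 := by
    rw [← mul_inv_eq_one, mul_inv_rev, ← mul_assoc]
    exact PresentedGroup.one_of_mem (Or.inr (Or.inr (Or.inr (Or.inl
      ⟨ℓ, i, j, h1, by omega, h3, by omega, h4, by omega, rfl⟩))))
  comm_next ℓ i j h1 h2 h3 h4 h5 h6 h7 := by
    rw [commute_iff_eq, ← mul_inv_eq_one, mul_inv_rev, ← mul_assoc]
    exact PresentedGroup.one_of_mem (Or.inr (Or.inr (Or.inr (Or.inr (Or.inl
      ⟨ℓ, i, j, h1, by omega, h3, h4, h5, h6, by omega, rfl⟩)))))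
  comm_far ℓ k i j h1 h2 h3 h4 h5 h6 h7 := by
    rw [commute_iff_eq, ← mul_inv_eq_one, mul_inv_rev, ← mul_assoc]
    exact PresentedGroup.one_of_mem (Or.inr (Or.inr (Or.inr (Or.inr (Or.inr
      ⟨ℓ, k, i, j, by omega, h2, h3, h4, h5, h6, h7, rfl⟩)))))

/-- The image of a reduced generator in `B(p,q)`. -/
def reducedGenToB (M N : ℕ) : ReducedGen M N → B (N + 3) (M + 3)
  | none => PresentedGroup.mk _ (ga (N + 3) (M + 3) 2 1)
  | some (ℓ, i) => PresentedGroup.mk _ (gb (N + 3) (M + 3) (ℓ + 1) (i + 1))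

lemma lift_reducedGenToB_reducedB (M N ℓ i : ℕ) :
    FreeGroup.lift (reducedGenToB M N) (reducedB M N ℓ i) =
      PresentedGroup.mk _ (gb (N + 3) (M + 3) ℓ i) := by
  by_cases h : 1 ≤ ℓ ∧ ℓ ≤ M + 2 ∧ 1 ≤ i ∧ i ≤ N + 2
  · rw [reducedB, dif_pos h, FreeGroup.lift_apply_of]
    simp only [reducedGenToB, Nat.sub_add_cancel h.1, Nat.sub_add_cancel h.2.2.1]
  · rw [reducedB, dif_neg h, gb, dif_neg (by exact h), map_one, map_one]

lemma lift_reducedGenToB_relator (M N : ℕ) (r : FreeGroup (ReducedGen M N))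
    (hr : r ∈ Set.range (relator M N)) : FreeGroup.lift (reducedGenToB M N) r = 1 := by
  obtain ⟨k, rfl⟩ := hr
  have h := (commutatorRelations_iff M N _ _).1
    ((braidRelations_B M N).commutatorRelations (by omega) (by omega)) k
  simp only [← lift_reducedGenToB_reducedB] at h
  have e : PresentedGroup.mk (Brels (N + 3) (M + 3)) (ga (N + 3) (M + 3) 2 1) =
    FreeGroup.lift (reducedGenToB M N) (FreeGroup.of none) := by
      rw [FreeGroup.lift_apply_of]; rfl
  rw [e, map_commutingPair, commute_iff_eq, ← mul_inv_eq_one, mul_inv_rev, ← mul_assoc] at h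
  simpa [relator] using h

/-- The image of a generator of `B(p,q)` in the group with the commutator presentation. -/
def genToReduced (M N : ℕ) (g : BGen (N + 3) (M + 3)) :
    PresentedGroup (Set.range (relator M N)) :=
  PresentedGroup.mk _ <|
    match g.1 with
    | (0, ℓ, i) => wordA (reducedB M N) (FreeGroup.of none) ℓ i
    | (1, ℓ, i) => reducedB M N ℓ i
    | (2, ℓ, i) => wordC (M + 2) (reducedB M N) (FreeGroup.of none) ℓ i

lemma lift_genToReduced_ga {M N ℓ i : ℕ} (h1 : 1 ≤ ℓ) (h2 : ℓ ≤ M + 2) (h3 : 1 ≤ i)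
    (h4 : i ≤ N + 2) :
    FreeGroup.lift (genToReduced M N) (ga (N + 3) (M + 3) ℓ i) =
      PresentedGroup.mk _ (wordA (reducedB M N) (FreeGroup.of none) ℓ i) := by
  rw [ga, dif_pos ⟨h1, h2, h3, h4⟩]
  exact FreeGroup.lift_apply_of

lemma lift_genToReduced_gb {M N ℓ i : ℕ} (h1 : 1 ≤ ℓ) (h2 : ℓ ≤ M + 2) (h3 : 1 ≤ i)
    (h4 : i ≤ N + 2) :
    FreeGroup.lift (genToReduced M N) (gb (N + 3) (M + 3) ℓ i) =
      PresentedGroup.mk _ (reducedB M N ℓ i) := by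
  rw [gb, dif_pos ⟨h1, h2, h3, h4⟩]
  exact FreeGroup.lift_apply_of

lemma lift_genToReduced_gc {M N ℓ i : ℕ} (h1 : 1 ≤ ℓ) (h2 : ℓ ≤ M + 2) (h3 : 1 ≤ i)
    (h4 : i ≤ N + 2) :
    FreeGroup.lift (genToReduced M N) (gc (N + 3) (M + 3) ℓ i) =
      PresentedGroup.mk _ (wordC (M + 2) (reducedB M N) (FreeGroup.of none) ℓ i) := by
  rw [gc, dif_pos ⟨h1, h2, h3, h4⟩]
  exact FreeGroup.lift_apply_of

lemma lift_genToReduced_relator (M N : ℕ) (r : FreeGroup (BGen (N + 3) (M + 3)))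
    (hr : r ∈ Brels (N + 3) (M + 3)) : FreeGroup.lift (genToReduced M N) r = 1 := by
  have h := (commutatorRelations_reduced M N).braidRelations (by omega)
  rcases hr with rfl | rfl | ⟨ℓ, i, j, h1, h2, h3, h4, h5, rfl⟩ |
    ⟨ℓ, i, j, h1, h2, h3, h4, h5, h6, rfl⟩ | ⟨ℓ, i, j, h1, h2, h3, h4, h5, h6, h7, rfl⟩ |
    ⟨ℓ, k, i, j, h1, h2, h3, h4, h5, h6, h7, rfl⟩
  · rw [lift_genToReduced_ga (by omega) (by omega) (by omega) (by omega), map_wordA]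
    exact h.a_one
  · rw [lift_genToReduced_gc (by omega) (by omega) (by omega) (by omega), map_wordC]
    exact h.c_last
  · simp only [map_mul, map_inv]
    rw [lift_genToReduced_ga (by omega) (by omega) (by omega) (by omega),
      lift_genToReduced_gb (by omega) (by omega) (by omega) (by omega),
      lift_genToReduced_gc (by omega) (by omega) (by omega) (by omega), map_wordA, map_wordC,
      mul_inv_eq_one]
    exact h.conj ℓ i j h1 h2 h3 h4 h5
  · simp only [map_mul, map_inv]
    rw [lift_genToReduced_ga (by omega) (by omega) (by omega) (by omega),
      lift_genToReduced_gb (by omega) (by omega) (by omega) (by omega),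
      lift_genToReduced_gb (by omega) (by omega) (by omega) (by omega),
      lift_genToReduced_gc (by omega) (by omega) (by omega) (by omega), map_wordA, map_wordC,
      mul_assoc, ← mul_inv_rev, mul_inv_eq_one]
    exact h.square ℓ i j h1 (by omega) h3 h5 (by omega)
  · simp only [gcomm, map_mul, map_inv]
    rw [lift_genToReduced_ga (by omega) (by omega) (by omega) (by omega),
      lift_genToReduced_gc (by omega) (by omega) (by omega) (by omega), map_wordA, map_wordC,
      mul_assoc, ← mul_inv_rev, mul_inv_eq_one]
    exact h.comm_next ℓ i j h1 (by omega) h3 h4 h5 h6 (by omega)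
  · simp only [gcomm, map_mul, map_inv]
    rw [lift_genToReduced_ga (by omega) (by omega) (by omega) (by omega),
      lift_genToReduced_gc (by omega) (by omega) (by omega) (by omega), map_wordA, map_wordC,
      mul_assoc, ← mul_inv_rev, mul_inv_eq_one]
    exact h.comm_far ℓ k i j (by omega) h2 h3 h4 h5 h6 h7

/-- The homomorphism from the commutator presentation to `B(p,q)`. -/
def toB (M N : ℕ) : PresentedGroup (Set.range (relator M N)) →* B (N + 3) (M + 3) :=
  PresentedGroup.toGroup (lift_reducedGenToB_relator M N)

/-- The homomorphism from `B(p,q)` to the commutator presentation. -/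
def ofB (M N : ℕ) : B (N + 3) (M + 3) →* PresentedGroup (Set.range (relator M N)) :=
  PresentedGroup.toGroup (lift_genToReduced_relator M N)

lemma toB_mk (M N : ℕ) (w : FreeGroup (ReducedGen M N)) :
    toB M N (PresentedGroup.mk _ w) = FreeGroup.lift (reducedGenToB M N) w := rfl

lemma ofB_mk (M N : ℕ) (w : FreeGroup (BGen (N + 3) (M + 3))) :
    ofB M N (PresentedGroup.mk _ w) = FreeGroup.lift (genToReduced M N) w := rfl

lemma ofB_comp_toB (M N : ℕ) : (ofB M N).comp (toB M N) = MonoidHom.id _ := by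
  refine PresentedGroup.ext fun g => ?_
  rw [MonoidHom.comp_apply, MonoidHom.id_apply, PresentedGroup.of, toB_mk, FreeGroup.lift_apply_of]
  rcases g with _ | ⟨ℓ, i⟩
  · rw [reducedGenToB, ofB_mk, lift_genToReduced_ga (by omega) (by omega) (by omega) (by omega),
      wordA_add_two _ _ 0]
    simp [firstA]
  · rw [reducedGenToB, ofB_mk, lift_genToReduced_gb (by omega) (by omega) (by omega) (by omega),
      reducedB, dif_pos ⟨by omega, by omega, by omega, by omega⟩]
    rfl

lemma toB_comp_ofB (M N : ℕ) : (toB M N).comp (ofB M N) = MonoidHom.id _ := by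
  have hB := braidRelations_B M N
  have e : FreeGroup.lift (reducedGenToB M N) (FreeGroup.of none) =
      PresentedGroup.mk (Brels (N + 3) (M + 3)) (ga (N + 3) (M + 3) 2 1) := by
    rw [FreeGroup.lift_apply_of]; rfl
  refine PresentedGroup.ext fun g => ?_
  rw [MonoidHom.comp_apply, MonoidHom.id_apply, PresentedGroup.of, ofB_mk, FreeGroup.lift_apply_of]
  obtain ⟨⟨t, ℓ, i⟩, h1, h2, h3, h4⟩ := g
  fin_cases t
  · have h := hB.a_eq_wordA (by omega) (by omega) h1 h2 h3 h4
    change FreeGroup.lift (reducedGenToB M N) (wordA (reducedB M N) (FreeGroup.of none) ℓ i) = _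
    simp only [map_wordA, lift_reducedGenToB_reducedB, e]
    rw [← h, ga, dif_pos ⟨h1, h2, h3, h4⟩]; rfl
  · change FreeGroup.lift (reducedGenToB M N) (reducedB M N ℓ i) = _
    rw [lift_reducedGenToB_reducedB, gb, dif_pos ⟨h1, h2, h3, h4⟩]; rfl
  · have h := hB.c_eq_wordC (by omega) (by omega) h1 h2 h3 h4
    change FreeGroup.lift (reducedGenToB M N)
      (wordC (M + 2) (reducedB M N) (FreeGroup.of none) ℓ i) = _
    simp only [map_wordC, lift_reducedGenToB_reducedB, e]
    rw [← h, gc, dif_pos ⟨h1, h2, h3, h4⟩]; rfl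

end SquareBraid

/-- **Theorem (simple commutator-related structure).**
For all integers `p ≥ q ≥ 3`, the group `B(p,q)` admits a presentation with exactly
`β₁(p,q)` generators and exactly `β₂(p,q)` relators, in which every relator is a
commutator `x * y * x⁻¹ * y⁻¹`. -/
theorem B_has_simple_commutator_related_structure (p q : ℕ) (hq : 3 ≤ q) (hpq : q ≤ p) :
    ∃ r : Fin (beta2 p q) → FreeGroup (Fin (beta1 p q)),
      (∀ k : Fin (beta2 p q), ∃ x y : FreeGroup (Fin (beta1 p q)),
        r k = x * y * x⁻¹ * y⁻¹) ∧
      Nonempty (PresentedGroup (Set.range r) ≃* B p q) := by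
  obtain ⟨M, rfl⟩ := Nat.exists_eq_add_of_le' hq
  obtain ⟨N, rfl⟩ := Nat.exists_eq_add_of_le' (hq.trans hpq)
  let eK := (Fintype.equivFinOfCardEq (SquareBraid.card_relatorIndex M N)).symm
  let eG := Fintype.equivFinOfCardEq (SquareBraid.card_reducedGen M N)
  let e : PresentedGroup (Set.range (SquareBraid.relator M N)) ≃* B (N + 3) (M + 3) :=
    MonoidHom.toMulEquiv _ _ (SquareBraid.ofB_comp_toB M N) (SquareBraid.toB_comp_ofB M N)
  refine ⟨fun k => FreeGroup.freeGroupCongr eG (SquareBraid.relator M N (eK k)), fun k => ?_, ?_⟩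
  · simp only [SquareBraid.relator, map_mul, map_inv]
    exact ⟨_, _, rfl⟩
  · have hr : Set.range (fun k => FreeGroup.freeGroupCongr eG (SquareBraid.relator M N (eK k))) =
        FreeGroup.freeGroupCongr eG '' Set.range (SquareBraid.relator M N) := by
      rw [← Set.range_comp, ← eK.surjective.range_comp]
      rfl
    rw [hr]
    exact ⟨(PresentedGroup.equivPresentedGroup _ eG).symm.trans e⟩
end

section
/- For all integers p ≥ q ≥ 3, every finite presentation of B(p,q) has at least β1(p,q) generators and at least β2(p,q) relators; precisely, if α and ι are finite types and r : ι → FreeGroup α is a family of relators such that the presented group with generators α and relators r is isomorphic to B(p,q), then card α ≥ β1(p,q) and card ι ≥ β2(p,q). -/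
section RelatorCount

variable {J K : Type}

/-- The central extension of `J → ℚ` by `K → ℚ` whose cocycle has `k`-th component
`(x, y) ↦ x (s k) * y (t k)`. -/
@[ext]
structure HeisenbergExt (s t : K → J) where
  /-- The image in the quotient. -/
  base : J → ℚ
  /-- The central coordinate. -/
  fiber : K → ℚ

namespace HeisenbergExt

variable {s t : K → J}

instance : Mul (HeisenbergExt s t) :=
  ⟨fun x y => ⟨x.base + y.base, fun k => x.fiber k + y.fiber k + x.base (s k) * y.base (t k)⟩⟩

instance : One (HeisenbergExt s t) := ⟨⟨0, 0⟩⟩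

instance : Inv (HeisenbergExt s t) :=
  ⟨fun x => ⟨-x.base, fun k => -x.fiber k + x.base (s k) * x.base (t k)⟩⟩

@[simp] lemma base_mul (x y : HeisenbergExt s t) : (x * y).base = x.base + y.base := rfl

@[simp] lemma fiber_mul (x y : HeisenbergExt s t) (k : K) :
    (x * y).fiber k = x.fiber k + y.fiber k + x.base (s k) * y.base (t k) := rfl

@[simp] lemma base_one : (1 : HeisenbergExt s t).base = 0 := rfl

@[simp] lemma fiber_one : (1 : HeisenbergExt s t).fiber = 0 := rfl

@[simp] lemma base_inv (x : HeisenbergExt s t) : x⁻¹.base = -x.base := rfl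

@[simp] lemma fiber_inv (x : HeisenbergExt s t) (k : K) :
    x⁻¹.fiber k = -x.fiber k + x.base (s k) * x.base (t k) := rfl

instance : Group (HeisenbergExt s t) :=
  Group.ofLeftAxioms
    (fun x y z => by
      ext k
      · simp [add_assoc]
      · simp; ring)
    (fun x => by ext k <;> simp)
    (fun x => by ext k <;> simp)

/-- The projection to the quotient. -/
def baseHom : HeisenbergExt s t →* Multiplicative (J → ℚ) where
  toFun x := Multiplicative.ofAdd x.base
  map_one' := rfl
  map_mul' _ _ := rfl

lemma fiber_commutator (x y : HeisenbergExt s t) (k : K) :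
    (x * y * x⁻¹ * y⁻¹).fiber k
      = x.base (s k) * y.base (t k) - x.base (t k) * y.base (s k) := by
  simp; ring

/-- The central subgroup of elements over `0` whose fiber coordinate lies in `S`. -/
def central (s t : K → J) (S : Submodule ℚ (K → ℚ)) : Subgroup (HeisenbergExt s t) where
  carrier := {x | x.base = 0 ∧ x.fiber ∈ S}
  one_mem' := ⟨rfl, S.zero_mem⟩
  mul_mem' := by
    rintro x y ⟨hx, hxS⟩ ⟨hy, hyS⟩
    refine ⟨by simp [hx, hy], ?_⟩
    have h : (x * y).fiber = x.fiber + y.fiber := by ext k; simp [hx]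
    exact h ▸ S.add_mem hxS hyS
  inv_mem' := by
    rintro x ⟨hx, hxS⟩
    refine ⟨by simp [hx], ?_⟩
    have h : x⁻¹.fiber = -x.fiber := by ext k; simp [hx]
    exact h ▸ S.neg_mem hxS

lemma central_normal (S : Submodule ℚ (K → ℚ)) : (central s t S).Normal := by
  refine ⟨fun x hx g => ?_⟩
  have h : g * x * g⁻¹ = x := by
    ext k
    · simp
    · simp [hx.1]; ring
  rwa [h]

end HeisenbergExt

/-- Vectors with exactly one nonzero coordinate each, one for every coordinate, span. -/
lemma card_le_of_diagonal [Fintype K] {ι : Type} [Fintype ι] (w : ι → K → ℚ)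
    (d : K → K → ℚ) (hd : ∀ k k', d k k' ≠ 0 ↔ k' = k)
    (hspan : ∀ k, d k ∈ Submodule.span ℚ (Set.range w)) :
    Fintype.card K ≤ Fintype.card ι := by
  classical
  have htop : Submodule.span ℚ (Set.range w) = ⊤ := by
    rw [eq_top_iff, ← (Pi.basisFun ℚ K).span_eq, Submodule.span_le]
    rintro _ ⟨k, rfl⟩
    have h : (Pi.basisFun ℚ K) k = (d k k)⁻¹ • d k := by
      ext k'
      by_cases hk : k' = k
      · subst hk
        simp [(hd k' k').2 rfl]
      · have h0 : d k k' = 0 := by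
          by_contra h0
          exact hk ((hd k k').1 h0)
        simp [h0, hk]
    rw [h]
    exact Submodule.smul_mem _ _ (hspan k)
  have h := finrank_range_le_card (R := ℚ) w
  rw [Set.finrank, htop, finrank_top, Module.finrank_fintype_fun_eq_card] at h
  exact h

variable {G : Type} [Group G] {α ι : Type} {r : ι → FreeGroup α}

/-- A presentation of `G` has at least as many relators as there are commuting pairs in `G` with
linearly independent wedge products in the second exterior power of the abelianization. -/
lemma card_le_card_relators [Fintype K] [Fintype ι]
    (e : PresentedGroup (Set.range r) ≃* G) (φ : G →* Multiplicative (J → ℚ)) (s t : K → J)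
    (u v : K → G) (huv : ∀ k, Commute (u k) (v k))
    (hd : ∀ k k', (φ (u k)).toAdd (s k') * (φ (v k)).toAdd (t k')
      - (φ (u k)).toAdd (t k') * (φ (v k)).toAdd (s k') ≠ 0 ↔ k' = k) :
    Fintype.card K ≤ Fintype.card ι := by
  let π : FreeGroup α →* G := e.toMonoidHom.comp (PresentedGroup.mk (Set.range r))
  have hπ : Function.Surjective π := e.surjective.comp (PresentedGroup.mk_surjective _)
  have hker : ∀ w, π w = 1 ↔ w ∈ Subgroup.normalClosure (Set.range r) := fun w => by
    rw [← PresentedGroup.mk_eq_one_iff, ← e.map_eq_one_iff]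
    rfl
  let Φ : FreeGroup α →* HeisenbergExt s t :=
    FreeGroup.lift fun a => ⟨(φ (π (FreeGroup.of a))).toAdd, 0⟩
  have hbase : ∀ w, (Φ w).base = (φ (π w)).toAdd := by
    have h : HeisenbergExt.baseHom.comp Φ = φ.comp π := by
      ext a : 1
      simp [Φ, HeisenbergExt.baseHom]
    exact fun w => congrArg Multiplicative.toAdd (DFunLike.congr_fun h w)
  let S := Submodule.span ℚ (Set.range fun i => (Φ (r i)).fiber)
  have hN : Subgroup.normalClosure (Set.range r) ≤ (HeisenbergExt.central s t S).comap Φ := by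
    have := (HeisenbergExt.central_normal (s := s) (t := t) S).comap Φ
    refine Subgroup.normalClosure_le_normal ?_
    rintro _ ⟨i, rfl⟩
    refine ⟨?_, Submodule.subset_span ⟨i, rfl⟩⟩
    rw [hbase, (hker _).2 (Subgroup.subset_normalClosure ⟨i, rfl⟩)]
    simp
  refine card_le_of_diagonal (fun i => (Φ (r i)).fiber) _ hd fun k => ?_
  obtain ⟨x, hx⟩ := hπ (u k)
  obtain ⟨y, hy⟩ := hπ (v k)
  have hxy : x * y * x⁻¹ * y⁻¹ ∈ Subgroup.normalClosure (Set.range r) := by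
    rw [← hker]
    simp only [map_mul, map_inv, hx, hy, (huv k).eq]
    group
  convert (hN hxy).2 using 1
  ext k'
  simp only [map_mul, map_inv]
  rw [HeisenbergExt.fiber_commutator, hbase, hbase, hx, hy]

/-- A presentation of `G` has at least as many generators as there are elements of `G` with
linearly independent images in the abelianization. -/
lemma card_le_card_generators [Fintype K] [Fintype α]
    (e : PresentedGroup (Set.range r) ≃* G) (φ : G →* Multiplicative (J → ℚ)) (s : K → J)
    (g : K → G) (hd : ∀ k k', (φ (g k)).toAdd (s k') ≠ 0 ↔ k' = k) :
    Fintype.card K ≤ Fintype.card α := by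
  let π : FreeGroup α →* G := e.toMonoidHom.comp (PresentedGroup.mk (Set.range r))
  have hπ : Function.Surjective π := e.surjective.comp (PresentedGroup.mk_surjective _)
  let ψ : FreeGroup α → K → ℚ := fun w k => (φ (π w)).toAdd (s k)
  refine card_le_of_diagonal (fun a => ψ (FreeGroup.of a)) _ hd fun k => ?_
  obtain ⟨x, hx⟩ := hπ (g k)
  have hmem : ∀ w, ψ w ∈ Submodule.span ℚ (Set.range fun a => ψ (FreeGroup.of a)) := by
    intro w
    induction w using FreeGroup.induction_on with
    | C1 =>
      have h : ψ 1 = 0 := by ext k; simp [ψ]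
      exact h ▸ Submodule.zero_mem _
    | of a => exact Submodule.subset_span ⟨a, rfl⟩
    | inv_of a ih =>
      have h : ψ (FreeGroup.of a)⁻¹ = -ψ (FreeGroup.of a) := by ext k; simp [ψ]
      exact h ▸ Submodule.neg_mem _ ih
    | mul x y hx hy =>
      have h : ψ (x * y) = ψ x + ψ y := by ext k; simp [ψ]
      exact h ▸ Submodule.add_mem _ hx hy
  have h := hmem x
  simpa only [ψ, hx] using h

end RelatorCount
section BRelations

variable {p q : ℕ}

/-- The image of `a_{ℓ,i}` in `B(p,q)`. -/
def genA (p q ℓ i : ℕ) : B p q := PresentedGroup.mk _ (ga p q ℓ i)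

/-- The image of `b_{ℓ,i}` in `B(p,q)`. -/
def genB (p q ℓ i : ℕ) : B p q := PresentedGroup.mk _ (gb p q ℓ i)

/-- The image of `c_{ℓ,i}` in `B(p,q)`. -/
def genC (p q ℓ i : ℕ) : B p q := PresentedGroup.mk _ (gc p q ℓ i)

lemma genB_conj_genA {ℓ i j : ℕ} (hℓ : 1 ≤ ℓ) (hℓq : ℓ ≤ q - 1) (hi : 1 ≤ i) (hij : i < j)
    (hj : j ≤ p - 1) : genB p q ℓ i * genA p q ℓ j * (genB p q ℓ i)⁻¹ = genC p q ℓ j := by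
  have h : gb p q ℓ i * ga p q ℓ j * (gb p q ℓ i)⁻¹ * (gc p q ℓ j)⁻¹ ∈ Brels p q :=
    Or.inr (Or.inr (Or.inl ⟨ℓ, i, j, hℓ, hℓq, hi, hij, hj, rfl⟩))
  simpa [genA, genB, genC] using PresentedGroup.mk_eq_mk_of_mul_inv_mem h

lemma genC_mul_genA {ℓ i j : ℕ} (hℓ : 1 ≤ ℓ) (hℓq : ℓ ≤ q - 2) (hi : 1 ≤ i) (hip : i ≤ p - 1)
    (hj : 1 ≤ j) (hjp : j ≤ p - i) :
    genC p q ℓ i * genA p q (ℓ + 1) j = genB p q (ℓ + 1) j * genB p q ℓ i := by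
  have h : gc p q ℓ i * ga p q (ℓ + 1) j * (gb p q ℓ i)⁻¹ * (gb p q (ℓ + 1) j)⁻¹ ∈ Brels p q :=
    Or.inr (Or.inr (Or.inr (Or.inl ⟨ℓ, i, j, hℓ, hℓq, hi, hip, hj, hjp, rfl⟩)))
  have h' := PresentedGroup.mk_eq_mk_of_mul_inv_mem h
  simp only [map_mul, map_inv] at h'
  exact mul_inv_eq_iff_eq_mul.1 h'

lemma commute_of_gcomm_mem {x y : FreeGroup (BGen p q)} (h : gcomm x y ∈ Brels p q) :
    Commute (PresentedGroup.mk (Brels p q) x) (PresentedGroup.mk (Brels p q) y) := by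
  have h' := PresentedGroup.mk_eq_mk_of_mul_inv_mem h
  simp only [map_mul, map_inv] at h'
  exact mul_inv_eq_iff_eq_mul.1 h'

lemma commute_genC_genA_succ {ℓ i j : ℕ} (hℓ : 1 ≤ ℓ) (hℓq : ℓ ≤ q - 2) (hi : 3 ≤ i)
    (hip : i ≤ p - 1) (hj : 3 ≤ j) (hjp : j ≤ p - 1) (hij : p + 2 ≤ i + j) :
    Commute (genC p q ℓ i) (genA p q (ℓ + 1) j) :=
  commute_of_gcomm_mem
    (Or.inr (Or.inr (Or.inr (Or.inr (Or.inl ⟨ℓ, i, j, hℓ, hℓq, hi, hip, hj, hjp, hij, rfl⟩)))))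

lemma commute_genC_genA {ℓ m i j : ℕ} (hℓ : 2 ≤ ℓ + 1) (hℓm : ℓ + 1 < m) (hm : m ≤ q - 1)
    (hi : 1 ≤ i) (hip : i ≤ p - 1) (hj : 1 ≤ j) (hjp : j ≤ p - 1) :
    Commute (genC p q ℓ i) (genA p q m j) :=
  commute_of_gcomm_mem
    (Or.inr (Or.inr (Or.inr (Or.inr (Or.inr ⟨ℓ, m, i, j, hℓ, hℓm, hm, hi, hip, hj, hjp, rfl⟩)))))

lemma commute_genB_genA {ℓ i j : ℕ} (hℓ : 1 ≤ ℓ) (hℓq : ℓ ≤ q - 1) (hi : 2 ≤ i) (hij : i < j)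
    (hj : j ≤ p - 1) : Commute ((genB p q ℓ 1)⁻¹ * genB p q ℓ i) (genA p q ℓ j) := by
  have h := (genB_conj_genA hℓ hℓq le_rfl (by omega : 1 < j) hj).trans
    (genB_conj_genA hℓ hℓq (by omega : 1 ≤ i) hij hj).symm
  generalize genB p q ℓ 1 = x, genB p q ℓ i = y, genA p q ℓ j = a at *
  calc x⁻¹ * y * a = x⁻¹ * (y * a * y⁻¹) * y := by group
    _ = a * (x⁻¹ * y) := by rw [← h]; group

lemma commute_genC_genA_quotients {ℓ i j : ℕ} (hℓ : 1 ≤ ℓ) (hℓq : ℓ ≤ q - 2) (hi : 2 ≤ i)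
    (hj : 2 ≤ j) (hij : i + j ≤ p) :
    Commute ((genC p q ℓ 1)⁻¹ * genC p q ℓ i)
      (genA p q (ℓ + 1) j * (genA p q (ℓ + 1) 1)⁻¹) := by
  have h11 := genC_mul_genA (p := p) (i := 1) (j := 1) hℓ hℓq (by omega) (by omega) (by omega)
    (by omega)
  have hi1 := genC_mul_genA (p := p) (i := i) (j := 1) hℓ hℓq (by omega) (by omega) (by omega)
    (by omega)
  have h1j := genC_mul_genA (p := p) (i := 1) (j := j) hℓ hℓq (by omega) (by omega) (by omega)
    (by omega)
  have hij := genC_mul_genA (p := p) (i := i) (j := j) hℓ hℓq (by omega) (by omega) (by omega)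
    (by omega)
  generalize genC p q ℓ 1 = c₁, genC p q ℓ i = c₂, genA p q (ℓ + 1) 1 = a₁,
    genA p q (ℓ + 1) j = a₂, genB p q ℓ 1 = b₁, genB p q ℓ i = b₂,
    genB p q (ℓ + 1) 1 = d₁, genB p q (ℓ + 1) j = d₂ at *
  calc c₁⁻¹ * c₂ * (a₂ * a₁⁻¹) = c₁⁻¹ * (c₂ * a₂) * a₁⁻¹ := by group
    _ = c₁⁻¹ * (d₂ * b₁) * (d₁ * b₁)⁻¹ * (d₁ * b₂) * a₁⁻¹ := by rw [hij]; group
    _ = a₂ * a₁⁻¹ * (c₁⁻¹ * c₂) := by rw [← h1j, ← h11, ← hi1]; group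

lemma commute_genA_quotient {ℓ i : ℕ} (hℓ : 1 ≤ ℓ) (hℓq : ℓ + 1 ≤ q - 2) (hi : 3 ≤ i)
    (hip : i ≤ p - 1) :
    Commute (genA p q (ℓ + 1) i * (genA p q (ℓ + 1) 2)⁻¹)
      ((genC p q ℓ 1)⁻¹ * (genB p q (ℓ + 2) 1)⁻¹ * genB p q (ℓ + 1) 1) := by
  have h1 := genC_mul_genA (p := p) (q := q) (ℓ := ℓ) (i := 1) (j := i) (by omega) (by omega)
    (by omega) (by omega) (by omega) (by omega)
  have h2 := genC_mul_genA (p := p) (q := q) (ℓ := ℓ) (i := 1) (j := 2) (by omega) (by omega)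
    (by omega) (by omega) (by omega) (by omega)
  have h3 := genC_mul_genA (p := p) (q := q) (ℓ := ℓ + 1) (i := i) (j := 1) (by omega) (by omega)
    (by omega) (by omega) (by omega) (by omega)
  have h4 := genC_mul_genA (p := p) (q := q) (ℓ := ℓ + 1) (i := 2) (j := 1) (by omega) (by omega)
    (by omega) (by omega) (by omega) (by omega)
  have h5 := genB_conj_genA (p := p) (q := q) (ℓ := ℓ + 1) (i := 1) (j := i) (by omega)
    (by omega) (by omega) (by omega) (by omega)
  have h6 := genB_conj_genA (p := p) (q := q) (ℓ := ℓ + 1) (i := 1) (j := 2) (by omega)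
    (by omega) (by omega) (by omega) (by omega)
  rw [← h5] at h3
  rw [← h6] at h4
  clear h5 h6
  simp only [add_assoc, Nat.reduceAdd] at h3 h4
  generalize genC p q ℓ 1 = c, genA p q (ℓ + 1) i = x, genA p q (ℓ + 1) 2 = y,
    genA p q (ℓ + 2) 1 = a, genB p q ℓ 1 = b, genB p q (ℓ + 1) 1 = d,
    genB p q (ℓ + 2) 1 = f, genB p q (ℓ + 1) i = bx, genB p q (ℓ + 1) 2 = bz at *
  have hlow : c * (x * y⁻¹) * c⁻¹ = bx * bz⁻¹ := by
    calc c * (x * y⁻¹) * c⁻¹ = (c * x) * (c * y)⁻¹ := by group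
      _ = bx * bz⁻¹ := by rw [h1, h2]; group
  have hhigh : f * (bx * bz⁻¹) * f⁻¹ = d * (x * y⁻¹) * d⁻¹ := by
    calc f * (bx * bz⁻¹) * f⁻¹ = (f * bx) * (f * bz)⁻¹ := by group
      _ = d * (x * y⁻¹) * d⁻¹ := by rw [← h3, ← h4]; group
  rw [← hlow] at hhigh
  refine Commute.symm ?_
  generalize x * y⁻¹ = z at *
  calc c⁻¹ * f⁻¹ * d * z = c⁻¹ * f⁻¹ * (d * z * d⁻¹) * d := by group
    _ = z * (c⁻¹ * f⁻¹ * d) := by rw [← hhigh]; group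

end BRelations

section Abelianization

variable {p q : ℕ}

/-- The standard basis vectors of `ℕ × ℕ → ℚ`. -/
def stdVec (x : ℕ × ℕ) : ℕ × ℕ → ℚ := fun y => if y = x then 1 else 0

/-- The images of the generators in the rational abelianization of `B(p,q)`. The basis vector
at `(ℓ, i)` belongs to the common class of `a_{ℓ,i}` and `c_{ℓ,i}`, except that `a_{1,1}` and `c_{q-1,1}` vanish;
the one at `(0, 0)` is the additional class detected by the generators `b_{ℓ,i}`. -/
def abVec (q : ℕ) (x : Fin 3 × ℕ × ℕ) : ℕ × ℕ → ℚ :=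
  if x.1 = 1 then stdVec x.2 + (-1 : ℚ) ^ x.2.1 • stdVec (0, 0)
  else if (x.1 = 0 ∧ x.2 = (1, 1)) ∨ (x.1 = 2 ∧ x.2 = (q - 1, 1)) then 0
  else stdVec x.2

/-- The homomorphism from the free group underlying the rational abelianization of `B(p,q)`. -/
def freeAb (p q : ℕ) : FreeGroup (BGen p q) →* Multiplicative (ℕ × ℕ → ℚ) :=
  FreeGroup.lift fun x => Multiplicative.ofAdd (abVec q x.1)

lemma freeAb_of (x : BGen p q) :
    freeAb p q (FreeGroup.of x) = Multiplicative.ofAdd (abVec q x.1) :=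
  FreeGroup.lift_apply_of

lemma freeAb_ga {ℓ i : ℕ} (hℓ : 1 ≤ ℓ) (hℓq : ℓ ≤ q - 1) (hi : 1 ≤ i) (hip : i ≤ p - 1) :
    (freeAb p q (ga p q ℓ i)).toAdd = if (ℓ, i) = (1, 1) then 0 else stdVec (ℓ, i) := by
  rw [ga, dif_pos ⟨hℓ, hℓq, hi, hip⟩]
  refine (congrArg Multiplicative.toAdd (freeAb_of (p := p) ⟨(0, ℓ, i), hℓ, hℓq, hi, hip⟩)).trans ?_
  simp [abVec]

lemma freeAb_gb {ℓ i : ℕ} (hℓ : 1 ≤ ℓ) (hℓq : ℓ ≤ q - 1) (hi : 1 ≤ i) (hip : i ≤ p - 1) :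
    (freeAb p q (gb p q ℓ i)).toAdd = stdVec (ℓ, i) + (-1 : ℚ) ^ ℓ • stdVec (0, 0) := by
  rw [gb, dif_pos ⟨hℓ, hℓq, hi, hip⟩]
  refine (congrArg Multiplicative.toAdd (freeAb_of (p := p) ⟨(1, ℓ, i), hℓ, hℓq, hi, hip⟩)).trans ?_
  simp [abVec]

lemma freeAb_gc {ℓ i : ℕ} (hℓ : 1 ≤ ℓ) (hℓq : ℓ ≤ q - 1) (hi : 1 ≤ i) (hip : i ≤ p - 1) :
    (freeAb p q (gc p q ℓ i)).toAdd = if (ℓ, i) = (q - 1, 1) then 0 else stdVec (ℓ, i) := by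
  rw [gc, dif_pos ⟨hℓ, hℓq, hi, hip⟩]
  refine (congrArg Multiplicative.toAdd (freeAb_of (p := p) ⟨(2, ℓ, i), hℓ, hℓq, hi, hip⟩)).trans ?_
  simp [abVec]

lemma freeAb_eq_one (hp : 3 ≤ p) (hq : 3 ≤ q) {w : FreeGroup (BGen p q)} (hw : w ∈ Brels p q) :
    freeAb p q w = 1 := by
  apply Multiplicative.toAdd.injective
  rcases hw with rfl | rfl | ⟨ℓ, i, j, h1, h2, h3, h4, h5, rfl⟩ |
    ⟨ℓ, i, j, h1, h2, h3, h4, h5, h6, rfl⟩ | ⟨ℓ, i, j, h1, h2, h3, h4, h5, h6, h7, rfl⟩ |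
    ⟨ℓ, m, i, j, h1, h2, h3, h4, h5, h6, h7, rfl⟩
  · rw [freeAb_ga] <;> first | omega | simp
  · rw [freeAb_gc] <;> first | omega | simp
  · simp only [map_mul, map_inv, toAdd_mul, toAdd_inv]
    rw [freeAb_ga (by omega) (by omega) (by omega) (by omega),
      freeAb_gc (by omega) (by omega) (by omega) (by omega)]
    simp [show j ≠ 1 by omega]
  · simp only [map_mul, map_inv, toAdd_mul, toAdd_inv]
    rw [freeAb_ga (by omega) (by omega) (by omega) (by omega),
      freeAb_gb (by omega) (by omega) (by omega) (by omega),
      freeAb_gb (by omega) (by omega) (by omega) (by omega),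
      freeAb_gc (by omega) (by omega) (by omega) (by omega)]
    simp only [Prod.mk.injEq, show ¬ (ℓ = q - 1 ∧ i = 1) by omega,
      show ¬ (ℓ + 1 = 1 ∧ j = 1) by omega, if_false, pow_succ, toAdd_one]
    module
  · simp [gcomm]
  · simp [gcomm]

/-- The rational abelianization of `B(p,q)`. -/
def abHom (hp : 3 ≤ p) (hq : 3 ≤ q) : B p q →* Multiplicative (ℕ × ℕ → ℚ) :=
  PresentedGroup.toGroup (f := fun x : BGen p q => Multiplicative.ofAdd (abVec q x.1))
    fun _ hw => freeAb_eq_one hp hq hw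

variable (hp : 3 ≤ p) (hq : 3 ≤ q)

lemma abHom_genA {ℓ i : ℕ} (hℓ : 1 ≤ ℓ) (hℓq : ℓ ≤ q - 1) (hi : 1 ≤ i) (hip : i ≤ p - 1)
    (h : ¬ (ℓ = 1 ∧ i = 1)) : (abHom hp hq (genA p q ℓ i)).toAdd = stdVec (ℓ, i) := by
  have h' := freeAb_ga hℓ hℓq hi hip
  rwa [if_neg (by simpa using h)] at h'

lemma abHom_genB {ℓ i : ℕ} (hℓ : 1 ≤ ℓ) (hℓq : ℓ ≤ q - 1) (hi : 1 ≤ i) (hip : i ≤ p - 1) :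
    (abHom hp hq (genB p q ℓ i)).toAdd = stdVec (ℓ, i) + (-1 : ℚ) ^ ℓ • stdVec (0, 0) :=
  freeAb_gb hℓ hℓq hi hip

lemma abHom_genC {ℓ i : ℕ} (hℓ : 1 ≤ ℓ) (hℓq : ℓ ≤ q - 1) (hi : 1 ≤ i) (hip : i ≤ p - 1)
    (h : ¬ (ℓ = q - 1 ∧ i = 1)) : (abHom hp hq (genC p q ℓ i)).toAdd = stdVec (ℓ, i) := by
  have h' := freeAb_gc hℓ hℓq hi hip
  rwa [if_neg (by simpa using h)] at h'

end Abelianization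
section LeadingPairs

variable {p q : ℕ}

/-- The alternating form `(f, g) ↦ f x * g y - f y * g x`. -/
def wedgeCoeff (x y : ℕ × ℕ) : (ℕ × ℕ → ℚ) →ₗ[ℚ] (ℕ × ℕ → ℚ) →ₗ[ℚ] ℚ :=
  LinearMap.mk₂ ℚ (fun f g => f x * g y - f y * g x)
    (fun _ _ _ => by simp; ring) (fun _ _ _ => by simp; ring)
    (fun _ _ _ => by simp; ring) (fun _ _ _ => by simp; ring)

/-- The pairs of basis indices at which the wedge product of exactly one of the chosen commuting
pairs of `B(p,q)` is supported. -/
def IsLeading (p q : ℕ) (x y : ℕ × ℕ) : Prop :=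
  (1 ≤ x.1 ∧ x.1 ≤ q - 1 ∧ y.1 = x.1 ∧ 2 ≤ x.2 ∧ x.2 < y.2 ∧ y.2 ≤ p - 1)
  ∨ (1 ≤ x.1 ∧ x.1 ≤ q - 2 ∧ y.1 = x.1 + 1 ∧ 2 ≤ x.2 ∧ 2 ≤ y.2 ∧ x.2 + y.2 ≤ p)
  ∨ (1 ≤ x.1 ∧ x.1 ≤ q - 2 ∧ y.1 = x.1 + 1 ∧ 3 ≤ x.2 ∧ x.2 ≤ p - 1 ∧ 3 ≤ y.2 ∧ y.2 ≤ p - 1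
      ∧ p + 2 ≤ x.2 + y.2)
  ∨ (1 ≤ x.1 ∧ x.1 + 1 < y.1 ∧ y.1 ≤ q - 1 ∧ 1 ≤ x.2 ∧ x.2 ≤ p - 1 ∧ 1 ≤ y.2 ∧ y.2 ≤ p - 1)
  ∨ (2 ≤ x.1 ∧ x.1 ≤ q - 2 ∧ 3 ≤ x.2 ∧ x.2 ≤ p - 1 ∧ y.1 = 0 ∧ y.2 = 0)

lemma wedgeCoeff_stdVec {x y a b : ℕ × ℕ} (h : IsLeading p q x y) (hba : ¬ IsLeading p q b a) :
    wedgeCoeff x y (stdVec a) (stdVec b) = if x = a ∧ y = b then 1 else 0 := by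
  have h' : ¬ (y = a ∧ x = b) := by rintro ⟨rfl, rfl⟩; exact hba h
  simp only [wedgeCoeff, LinearMap.mk₂_apply, stdVec, ← ite_and, mul_ite, mul_one, mul_zero]
  grind

lemma wedgeCoeff_stdVec_eq_zero {x y a b : ℕ × ℕ} (h : IsLeading p q x y)
    (hab : ¬ IsLeading p q a b) (hba : ¬ IsLeading p q b a) :
    wedgeCoeff x y (stdVec a) (stdVec b) = 0 := by
  rw [wedgeCoeff_stdVec h hba, if_neg]
  rintro ⟨rfl, rfl⟩
  exact hab h

lemma exists_commute_of_isLeading (hp : 3 ≤ p) (hq : 3 ≤ q) {a b : ℕ × ℕ}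
    (hab : IsLeading p q a b) :
    ∃ u v : B p q, Commute u v ∧ ∀ x y, IsLeading p q x y →
      (wedgeCoeff x y (abHom hp hq u).toAdd (abHom hp hq v).toAdd ≠ 0 ↔ x = a ∧ y = b) := by
  obtain ⟨ℓ, i⟩ := a
  obtain ⟨m, j⟩ := b
  rcases hab with ⟨h1, h2, h3, h4, h5, h6⟩ | ⟨h1, h2, h3, h4, h5, h6⟩ |
    ⟨h1, h2, h3, h4, h5, h6, h7, h8⟩ | ⟨h1, h2, h3, h4, h5, h6, h7⟩ | ⟨h1, h2, h3, h4, h5, h6⟩ <;>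
    dsimp only at *
  · subst m
    refine ⟨_, _, commute_genB_genA h1 h2 h4 h5 h6, fun x y hxy => ?_⟩
    have hu : (abHom hp hq ((genB p q ℓ 1)⁻¹ * genB p q ℓ i)).toAdd
        = stdVec (ℓ, i) - stdVec (ℓ, 1) := by
      simp only [map_mul, map_inv, toAdd_mul, toAdd_inv]
      rw [abHom_genB, abHom_genB] <;> first | omega | module
    rw [hu, abHom_genA hp hq (by omega) (by omega) (by omega) (by omega) (by omega),
      map_sub, LinearMap.sub_apply, wedgeCoeff_stdVec hxy (by simp only [IsLeading]; omega),
      wedgeCoeff_stdVec_eq_zero hxy (by simp only [IsLeading]; omega)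
        (by simp only [IsLeading]; omega)]
    simp
  · subst m
    refine ⟨_, _, commute_genC_genA_quotients h1 h2 h4 h5 h6, fun x y hxy => ?_⟩
    have hu : (abHom hp hq ((genC p q ℓ 1)⁻¹ * genC p q ℓ i)).toAdd
        = stdVec (ℓ, i) - stdVec (ℓ, 1) := by
      simp only [map_mul, map_inv, toAdd_mul, toAdd_inv]
      rw [abHom_genC, abHom_genC] <;> first | omega | module
    have hv : (abHom hp hq (genA p q (ℓ + 1) j * (genA p q (ℓ + 1) 1)⁻¹)).toAdd
        = stdVec (ℓ + 1, j) - stdVec (ℓ + 1, 1) := by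
      simp only [map_mul, map_inv, toAdd_mul, toAdd_inv]
      rw [abHom_genA, abHom_genA] <;> first | omega | module
    rw [hu, hv]
    simp only [map_sub, LinearMap.sub_apply]
    rw [wedgeCoeff_stdVec (a := (ℓ, i)) (b := (ℓ + 1, j)) hxy (by simp only [IsLeading]; omega)]
    iterate 3 rw [wedgeCoeff_stdVec_eq_zero hxy (by simp only [IsLeading]; omega)
      (by simp only [IsLeading]; omega)]
    simp
  · subst m
    refine ⟨_, _, commute_genC_genA_succ h1 h2 h4 h5 h6 h7 h8, fun x y hxy => ?_⟩
    rw [abHom_genC hp hq (by omega) (by omega) (by omega) (by omega) (by omega),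
      abHom_genA hp hq (by omega) (by omega) (by omega) (by omega) (by omega),
      wedgeCoeff_stdVec hxy (by simp only [IsLeading]; omega)]
    simp
  · refine ⟨_, _, commute_genC_genA (by omega) h2 h3 h4 h5 h6 h7, fun x y hxy => ?_⟩
    rw [abHom_genC hp hq (by omega) (by omega) (by omega) (by omega) (by omega),
      abHom_genA hp hq (by omega) (by omega) (by omega) (by omega) (by omega),
      wedgeCoeff_stdVec hxy (by simp only [IsLeading]; omega)]
    simp
  · subst m j
    obtain ⟨ℓ, rfl⟩ := Nat.exists_eq_add_of_le' (by omega : 1 ≤ ℓ)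
    refine ⟨_, _, commute_genA_quotient (by omega : 1 ≤ ℓ) h2 h3 h4, fun x y hxy => ?_⟩
    have hu : (abHom hp hq (genA p q (ℓ + 1) i * (genA p q (ℓ + 1) 2)⁻¹)).toAdd
        = stdVec (ℓ + 1, i) - stdVec (ℓ + 1, 2) := by
      simp only [map_mul, map_inv, toAdd_mul, toAdd_inv]
      rw [abHom_genA, abHom_genA] <;> first | omega | module
    have hv : (abHom hp hq
        ((genC p q ℓ 1)⁻¹ * (genB p q (ℓ + 2) 1)⁻¹ * genB p q (ℓ + 1) 1)).toAdd
        = stdVec (ℓ + 1, 1) - stdVec (ℓ, 1) - stdVec (ℓ + 2, 1)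
          + (2 * (-1 : ℚ) ^ (ℓ + 1)) • stdVec (0, 0) := by
      simp only [map_mul, map_inv, toAdd_mul, toAdd_inv]
      rw [abHom_genC, abHom_genB, abHom_genB] <;> first | omega | (simp only [pow_succ]; module)
    rw [hu, hv]
    simp only [map_sub, map_add, map_smul, LinearMap.sub_apply]
    rw [wedgeCoeff_stdVec (a := (ℓ + 1, i)) (b := (0, 0)) hxy (by simp only [IsLeading]; omega)]
    iterate 7 rw [wedgeCoeff_stdVec_eq_zero hxy (by simp only [IsLeading]; omega)
      (by simp only [IsLeading]; omega)]
    simp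

/-- A set with `n.choose 2` elements. -/
abbrev Triangle (n : ℕ) : Type := Σ b : Fin n, Fin b

lemma card_triangle (n : ℕ) : 2 * Fintype.card (Triangle n) = n * (n - 1) := by
  rw [Fintype.card_sigma]
  simp only [Fintype.card_fin]
  rw [Fin.sum_univ_eq_sum_range (fun b => b), mul_comm, Finset.sum_range_id_mul_two]

lemma triangle_ext {n : ℕ} {x y : Triangle n} (h1 : (x.1 : ℕ) = y.1) (h2 : (x.2 : ℕ) = y.2) :
    x = y := by
  obtain ⟨b, a⟩ := x
  obtain ⟨b', a'⟩ := y
  obtain rfl : b = b' := Fin.ext h1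
  obtain rfl : a = a' := Fin.ext h2
  rfl

/-- An index type for the leading pairs. -/
abbrev LeadIndex (p q : ℕ) : Type :=
  (Fin (q - 1) × Triangle (p - 2)) ⊕ (Fin (q - 2) × Triangle (p - 2))
    ⊕ (Fin (q - 2) × Triangle (p - 2)) ⊕ (Triangle (q - 2) × Fin (p - 1) × Fin (p - 1))
    ⊕ (Fin (q - 3) × Fin (p - 3))

/-- The leading pair of an index. -/
def leadPair (p q : ℕ) : LeadIndex p q → (ℕ × ℕ) × (ℕ × ℕ)
  | .inl (ℓ, ⟨b, a⟩) => ((ℓ + 1, a + 2), (ℓ + 1, b + 2))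
  | .inr (.inl (ℓ, ⟨b, a⟩)) => ((ℓ + 1, a + 2), (ℓ + 2, p - 1 - b))
  | .inr (.inr (.inl (ℓ, ⟨b, a⟩))) => ((ℓ + 1, b + 2), (ℓ + 2, p - 1 - a))
  | .inr (.inr (.inr (.inl (⟨m, ℓ⟩, i, j)))) => ((ℓ + 1, i + 1), (m + 2, j + 1))
  | .inr (.inr (.inr (.inr (ℓ, i)))) => ((ℓ + 2, i + 3), (0, 0))

lemma isLeading_leadPair (k : LeadIndex p q) :
    IsLeading p q (leadPair p q k).1 (leadPair p q k).2 := by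
  rcases k with ⟨ℓ, b, a⟩ | ⟨ℓ, b, a⟩ | ⟨ℓ, b, a⟩ | ⟨⟨m, ℓ⟩, i, j⟩ | ⟨ℓ, i⟩ <;>
    simp only [leadPair, IsLeading, true_and, and_true] <;> omega

lemma leadPair_injective : Function.Injective (leadPair p q) := by
  rintro (⟨ℓ, b, a⟩ | ⟨ℓ, b, a⟩ | ⟨ℓ, b, a⟩ | ⟨⟨m, ℓ⟩, i, j⟩ | ⟨ℓ, i⟩)
    (⟨ℓ', b', a'⟩ | ⟨ℓ', b', a'⟩ | ⟨ℓ', b', a'⟩ | ⟨⟨m', ℓ'⟩, i', j'⟩ | ⟨ℓ', i'⟩) h <;>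
    simp only [leadPair, Prod.mk.injEq] at h <;> try omega
  · have hℓ : ℓ = ℓ' := by omega
    have ht : (⟨b, a⟩ : Triangle (p - 2)) = ⟨b', a'⟩ := triangle_ext (by grind) (by grind)
    rw [hℓ, ht]
  · have hℓ : ℓ = ℓ' := by omega
    have ht : (⟨b, a⟩ : Triangle (p - 2)) = ⟨b', a'⟩ := triangle_ext (by grind) (by grind)
    rw [hℓ, ht]
  · have hℓ : ℓ = ℓ' := by omega
    have ht : (⟨b, a⟩ : Triangle (p - 2)) = ⟨b', a'⟩ := triangle_ext (by grind) (by grind)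
    rw [hℓ, ht]
  · have ht : (⟨m, ℓ⟩ : Triangle (q - 2)) = ⟨m', ℓ'⟩ := triangle_ext (by grind) (by grind)
    have hi : i = i' := by omega
    have hj : j = j' := by omega
    rw [ht, hi, hj]
  · have hℓ : ℓ = ℓ' := by omega
    have hi : i = i' := by omega
    rw [hℓ, hi]

lemma beta2_le_card_leadIndex (hp : 3 ≤ p) (hq : 3 ≤ q) :
    beta2 p q ≤ Fintype.card (LeadIndex p q) := by
  obtain ⟨P, rfl⟩ := Nat.exists_eq_add_of_le' hp
  obtain ⟨Q, rfl⟩ := Nat.exists_eq_add_of_le' hq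
  have hP := card_triangle (P + 1)
  have hQ := card_triangle (Q + 1)
  simp only [Fintype.card_sum, Fintype.card_prod, Fintype.card_fin]
  simp only [show P + 3 - 2 = P + 1 by omega, show P + 3 - 1 = P + 2 by omega,
    show P + 3 - 3 = P by omega, show Q + 3 - 2 = Q + 1 by omega,
    show Q + 3 - 1 = Q + 2 by omega, show Q + 3 - 3 = Q by omega, Nat.add_sub_cancel] at *
  generalize Fintype.card (Triangle (P + 1)) = x at *
  generalize Fintype.card (Triangle (Q + 1)) = y at *
  rw [beta2, Int.toNat_le]
  zify at hP hQ
  push_cast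
  have h : ((((P : ℤ) + 3) ^ 2 + 1) * (((Q : ℤ) + 3) ^ 2 + 1)
      - ((P : ℤ) + 3) * (Q + 3) * (2 * (P + 3) + 2 * (Q + 3) + 3)
      + 7 * ((P : ℤ) + 3 + (Q + 3) - 1))
      = 2 * ((Q + 2) * x + ((Q + 1) * x + ((Q + 1) * x + (y * ((P + 2) * (P + 2)) + Q * P)))) := by
    linear_combination (-(3 * (Q : ℤ) + 4)) * hP - ((P : ℤ) + 2) ^ 2 * hQ
  rw [h]
  simp

end LeadingPairs

/-- Elements of `B(p,q)` whose classes form a basis of the rational abelianization. -/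
def basisElement (p q : ℕ) : Option (Fin (q - 1) × Fin (p - 1)) → B p q
  | none => genB p q 1 1 * (genC p q 1 1)⁻¹
  | some (ℓ, i) => if (ℓ : ℕ) = 0 then genC p q 1 (i + 1) else genA p q (ℓ + 1) (i + 1)

/-- The index of the basis vector of `ℕ × ℕ → ℚ` proportional to the class of `basisElement`. -/
def basisIndex (p q : ℕ) : Option (Fin (q - 1) × Fin (p - 1)) → ℕ × ℕ
  | none => (0, 0)
  | some (ℓ, i) => (ℓ + 1, i + 1)

lemma abHom_basisElement {p q : ℕ} (hp : 3 ≤ p) (hq : 3 ≤ q)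
    (k k' : Option (Fin (q - 1) × Fin (p - 1))) :
    (abHom hp hq (basisElement p q k)).toAdd (basisIndex p q k') ≠ 0 ↔ k' = k := by
  obtain _ | ⟨ℓ, i⟩ := k
  · have h : (abHom hp hq (basisElement p q none)).toAdd = -stdVec (0, 0) := by
      simp only [basisElement, map_mul, map_inv, toAdd_mul, toAdd_inv]
      rw [abHom_genB, abHom_genC] <;> first | omega | module
    rw [h]
    obtain _ | ⟨ℓ', i'⟩ := k' <;> simp [basisIndex, stdVec]
  · have h : (abHom hp hq (basisElement p q (some (ℓ, i)))).toAdd = stdVec (ℓ + 1, i + 1) := by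
      simp only [basisElement]
      split_ifs with hℓ
      · rw [abHom_genC hp hq (by omega) (by omega) (by omega) (by omega) (by omega), hℓ]
      · rw [abHom_genA] <;> omega
    rw [h]
    obtain _ | ⟨ℓ', i'⟩ := k' <;> simp [basisIndex, stdVec, Fin.ext_iff]

/-- **Corollary (minimality of the presentation).**
For all integers `p ≥ q ≥ 3`, any finite presentation of `B(p,q)` has at least
`β₁(p,q)` generators and at least `β₂(p,q)` relators. -/
theorem B_presentation_minimality (p q : ℕ) (hq : 3 ≤ q) (hpq : q ≤ p)
    (α ι : Type) [Fintype α] [Fintype ι] (r : ι → FreeGroup α)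
    (h : Nonempty (PresentedGroup (Set.range r) ≃* B p q)) :
    beta1 p q ≤ Fintype.card α ∧ beta2 p q ≤ Fintype.card ι := by
  obtain ⟨e⟩ := h
  have hp : 3 ≤ p := hq.trans hpq
  constructor
  · have h := card_le_card_generators e (abHom hp hq) (basisIndex p q) (basisElement p q)
      (abHom_basisElement hp hq)
    simpa [beta1, mul_comm] using h
  · refine (beta2_le_card_leadIndex hp hq).trans ?_
    choose u v huv hd using fun k : LeadIndex p q =>
      exists_commute_of_isLeading hp hq (isLeading_leadPair k)
    refine card_le_card_relators e (abHom hp hq) (fun k => (leadPair p q k).1)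
      (fun k => (leadPair p q k).2) u v huv fun k k' => ?_
    refine (hd k _ _ (isLeading_leadPair k')).trans ?_
    rw [← Prod.ext_iff, leadPair_injective.eq_iff]
end

section
/- For all integers p ≥ q ≥ 3, the abelianization of B(p,q) is a free abelian group of rank (p−1)(q−1)+1, i.e., Abelianization B(p,q) is isomorphic to the direct sum of (p−1)(q−1)+1 copies of ℤ. -/
section Presentation

variable {p q : ℕ}

/-- `InRange p q ℓ i` says that `(ℓ, i)` is the index of a generator of `B(p,q)`. -/
def InRange (p q ℓ i : ℕ) : Prop := 1 ≤ ℓ ∧ ℓ ≤ q - 1 ∧ 1 ≤ i ∧ i ≤ p - 1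

/-- The generator of type `t` at position `(ℓ, i)`. -/
def InRange.gen {ℓ i : ℕ} (h : InRange p q ℓ i) (t : Fin 3) : BGen p q := ⟨(t, ℓ, i), h⟩

theorem ga_eq_of {ℓ i : ℕ} (h : InRange p q ℓ i) : ga p q ℓ i = FreeGroup.of (h.gen 0) :=
  dif_pos h

theorem gb_eq_of {ℓ i : ℕ} (h : InRange p q ℓ i) : gb p q ℓ i = FreeGroup.of (h.gen 1) :=
  dif_pos h

theorem gc_eq_of {ℓ i : ℕ} (h : InRange p q ℓ i) : gc p q ℓ i = FreeGroup.of (h.gen 2) :=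
  dif_pos h

/-- Three families in an additive group satisfying the abelianized relations of `B(p,q)`. -/
structure AbelianRelations {G : Type*} [AddCommGroup G] (p q : ℕ) (a b c : ℕ → ℕ → G) :
    Prop where
  a_one_one : a 1 1 = 0
  c_last_one : c (q - 1) 1 = 0
  a_eq_c : ∀ ℓ j, 1 ≤ ℓ → ℓ ≤ q - 1 → 2 ≤ j → j ≤ p - 1 → a ℓ j = c ℓ j
  c_add_a : ∀ ℓ i j, 1 ≤ ℓ → ℓ ≤ q - 2 → 1 ≤ i → i ≤ p - 1 → 1 ≤ j → j ≤ p - i →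
    c ℓ i + a (ℓ + 1) j = b ℓ i + b (ℓ + 1) j

namespace AbelianRelations

variable {G : Type*} [AddCommGroup G] {a b c : ℕ → ℕ → G}

theorem c_sub_b_eq (h : AbelianRelations p q a b c) {ℓ i : ℕ} (hℓ : 1 ≤ ℓ) (hℓ' : ℓ ≤ q - 2)
    (hi : 1 ≤ i) (hi' : i ≤ p - 1) : c ℓ i - b ℓ i = c ℓ 1 - b ℓ 1 := by
  have h₁ := h.c_add_a ℓ i 1 hℓ hℓ' hi hi' le_rfl (by omega)
  have h₂ := h.c_add_a ℓ 1 1 hℓ hℓ' le_rfl (by omega) le_rfl (by omega)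
  rw [sub_eq_sub_iff_add_eq_add]
  have := congrArg₂ (· - ·) h₁ h₂
  simp only [add_sub_add_right_eq_sub] at this
  rwa [sub_eq_sub_iff_add_eq_add, add_comm (b ℓ i)] at this

theorem b_sub_a_eq (h : AbelianRelations p q a b c) {ℓ j : ℕ} (hℓ : 1 ≤ ℓ) (hℓ' : ℓ ≤ q - 2)
    (hj : 1 ≤ j) (hj' : j ≤ p - 1) : b (ℓ + 1) j - a (ℓ + 1) j = c ℓ 1 - b ℓ 1 := by
  have h₁ := h.c_add_a ℓ 1 j hℓ hℓ' le_rfl (by omega) hj hj'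
  rw [sub_eq_sub_iff_add_eq_add, add_comm, ← h₁]

theorem c_one_sub_b_one (h : AbelianRelations p q a b c) (hp : 3 ≤ p) {ℓ : ℕ} (hℓ : ℓ + 1 ≤ q - 2) :
    c (ℓ + 1) 1 - b (ℓ + 1) 1 = (-1 : ℤ) ^ ℓ • (c 1 1 - b 1 1) := by
  induction ℓ with
  | zero => simp
  | succ ℓ ih =>
    have h₁ := h.b_sub_a_eq (ℓ := ℓ + 1) (j := 2) (by omega) (by omega) (by omega) (by omega)
    have h₂ := h.c_sub_b_eq (ℓ := ℓ + 1 + 1) (i := 2) (by omega) (by omega) (by omega) (by omega)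
    have h₃ := h.a_eq_c (ℓ + 1 + 1) 2 (by omega) (by omega) le_rfl (by omega)
    rw [pow_succ', mul_smul, ← ih (by omega), ← h₁, ← h₂, h₃]
    simp

theorem a_succ_eq (h : AbelianRelations p q a b c) (hp : 3 ≤ p) (hq : 3 ≤ q) {ℓ i : ℕ}
    (hℓ : ℓ + 1 ≤ q - 1) (hi : 1 ≤ i) (hi' : i ≤ p - 1) (hne : ¬ (ℓ = 0 ∧ i = 1)) :
    a (ℓ + 1) i = b (ℓ + 1) i + (-1 : ℤ) ^ ℓ • (c 1 1 - b 1 1) := by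
  cases ℓ with
  | zero =>
    rw [h.a_eq_c _ _ (by omega) (by omega) (by omega) hi',
      ← h.c_sub_b_eq (ℓ := 1) le_rfl (by omega) hi hi']
    simp
  | succ ℓ =>
    have h₁ := h.b_sub_a_eq (ℓ := ℓ + 1) (by omega) (by omega) hi hi'
    rw [pow_succ', mul_smul, ← h.c_one_sub_b_one hp (by omega), ← h₁]
    simp

theorem c_succ_eq (h : AbelianRelations p q a b c) (hp : 3 ≤ p) (hq : 3 ≤ q) {ℓ i : ℕ}
    (hℓ : ℓ + 1 ≤ q - 1) (hi : 1 ≤ i) (hi' : i ≤ p - 1) (hne : ¬ (ℓ + 1 = q - 1 ∧ i = 1)) :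
    c (ℓ + 1) i = b (ℓ + 1) i + (-1 : ℤ) ^ ℓ • (c 1 1 - b 1 1) := by
  by_cases hlast : ℓ + 1 = q - 1
  · rw [← h.a_eq_c _ _ (by omega) hℓ (by omega) hi', h.a_succ_eq hp hq hℓ hi hi' (by omega)]
  · rw [← h.c_one_sub_b_one hp (by omega), ← h.c_sub_b_eq (by omega) (by omega) hi hi']
    simp

end AbelianRelations

/-- Index set of a basis of the abelianization: `some (ℓ, i)` stands for `b_{ℓ,i}` and `none`
for `c_{1,1} - b_{1,1}`. -/
abbrev BasisIndex (p q : ℕ) : Type :=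
  Option (Finset.Icc 1 (q - 1) ×ˢ Finset.Icc 1 (p - 1) : Finset (ℕ × ℕ))

namespace BasisIndex

/-- The element of the free abelian group corresponding to `b_{ℓ,i}`, or `0` if out of range. -/
noncomputable def bVec (p q ℓ i : ℕ) : BasisIndex p q →₀ ℤ :=
  if h : (ℓ, i) ∈ Finset.Icc 1 (q - 1) ×ˢ Finset.Icc 1 (p - 1) then
    Finsupp.single (some ⟨(ℓ, i), h⟩) 1 else 0

/-- The element of the free abelian group corresponding to `a_{ℓ,i}`. -/
noncomputable def aVec (p q ℓ i : ℕ) : BasisIndex p q →₀ ℤ :=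
  if ℓ = 1 ∧ i = 1 then 0 else bVec p q ℓ i + (-1 : ℤ) ^ (ℓ - 1) • Finsupp.single none 1

/-- The element of the free abelian group corresponding to `c_{ℓ,i}`. -/
noncomputable def cVec (p q ℓ i : ℕ) : BasisIndex p q →₀ ℤ :=
  if ℓ = q - 1 ∧ i = 1 then 0 else bVec p q ℓ i + (-1 : ℤ) ^ (ℓ - 1) • Finsupp.single none 1

theorem abelianRelations (p q : ℕ) :
    AbelianRelations p q (aVec p q) (bVec p q) (cVec p q) where
  a_one_one := by simp [aVec]
  c_last_one := by simp [cVec]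
  a_eq_c ℓ j _ _ hj _ := by
    rw [aVec, cVec, if_neg (by omega), if_neg (by omega)]
  c_add_a ℓ i j hℓ hℓ' _ _ _ _ := by
    obtain ⟨k, rfl⟩ : ∃ k, ℓ = k + 1 := ⟨ℓ - 1, by omega⟩
    rw [aVec, cVec, if_neg (by omega), if_neg (by omega)]
    simp only [Nat.add_sub_cancel, pow_succ, mul_neg, mul_one, neg_smul]
    abel

/-- The image of a generator of `B(p,q)` in the free abelian group. -/
noncomputable def genVec (x : BGen p q) : BasisIndex p q →₀ ℤ :=
  ![aVec p q x.1.2.1 x.1.2.2, bVec p q x.1.2.1 x.1.2.2, cVec p q x.1.2.1 x.1.2.2] x.1.1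

theorem card (p q : ℕ) : Fintype.card (BasisIndex p q) = (p - 1) * (q - 1) + 1 := by
  simp [mul_comm]

end BasisIndex

/-- The class of a word in the abelianization of `B(p,q)`, written additively. -/
def wordClass (p q : ℕ) (w : FreeGroup (BGen p q)) : Additive (Abelianization (B p q)) :=
  Additive.ofMul (Abelianization.of (PresentedGroup.mk (Brels p q) w))

theorem wordClass_mul (v w : FreeGroup (BGen p q)) :
    wordClass p q (v * w) = wordClass p q v + wordClass p q w := by
  simp [wordClass]

theorem wordClass_inv (w : FreeGroup (BGen p q)) : wordClass p q w⁻¹ = -wordClass p q w := by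
  simp [wordClass]

theorem wordClass_eq_zero {r : FreeGroup (BGen p q)} (hr : r ∈ Brels p q) :
    wordClass p q r = 0 := by
  simp [wordClass, PresentedGroup.one_of_mem hr]

theorem abelianRelations_wordClass (p q : ℕ) :
    AbelianRelations p q (fun ℓ i ↦ wordClass p q (ga p q ℓ i))
      (fun ℓ i ↦ wordClass p q (gb p q ℓ i)) (fun ℓ i ↦ wordClass p q (gc p q ℓ i)) where
  a_one_one := wordClass_eq_zero (Or.inl rfl)
  c_last_one := wordClass_eq_zero (Or.inr (Or.inl rfl))
  a_eq_c ℓ j h₁ h₂ h₃ h₄ := by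
    have := wordClass_eq_zero (Or.inr (Or.inr (Or.inl
      ⟨ℓ, 1, j, h₁, h₂, le_rfl, h₃, h₄, rfl⟩)))
    simp only [wordClass_mul, wordClass_inv] at this
    rw [← sub_eq_zero, ← this]
    abel
  c_add_a ℓ i j h₁ h₂ h₃ h₄ h₅ h₆ := by
    have := wordClass_eq_zero (Or.inr (Or.inr (Or.inr (Or.inl
      ⟨ℓ, i, j, h₁, h₂, h₃, h₄, h₅, h₆, rfl⟩))))
    simp only [wordClass_mul, wordClass_inv] at this
    rw [← sub_eq_zero, ← this]
    abel

open BasisIndex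

theorem lift_genVec_eq_one (hq : 3 ≤ q) (hp : 3 ≤ p) : ∀ r ∈ Brels p q,
    FreeGroup.lift (fun x : BGen p q ↦ Multiplicative.ofAdd (genVec x)) r = 1 := by
  have hrel := abelianRelations p q
  have ha : ∀ ℓ i, InRange p q ℓ i →
      FreeGroup.lift (fun x : BGen p q ↦ Multiplicative.ofAdd (genVec x)) (ga p q ℓ i) =
        Multiplicative.ofAdd (aVec p q ℓ i) := fun ℓ i h ↦ by
    rw [ga_eq_of h, FreeGroup.lift_apply_of]; rfl
  have hb : ∀ ℓ i, InRange p q ℓ i →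
      FreeGroup.lift (fun x : BGen p q ↦ Multiplicative.ofAdd (genVec x)) (gb p q ℓ i) =
        Multiplicative.ofAdd (bVec p q ℓ i) := fun ℓ i h ↦ by
    rw [gb_eq_of h, FreeGroup.lift_apply_of]; rfl
  have hc : ∀ ℓ i, InRange p q ℓ i →
      FreeGroup.lift (fun x : BGen p q ↦ Multiplicative.ofAdd (genVec x)) (gc p q ℓ i) =
        Multiplicative.ofAdd (cVec p q ℓ i) := fun ℓ i h ↦ by
    rw [gc_eq_of h, FreeGroup.lift_apply_of]; rfl
  unfold InRange at ha hb hc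
  rintro r (rfl | rfl | ⟨ℓ, i, j, h₁, h₂, h₃, h₄, h₅, rfl⟩ |
    ⟨ℓ, i, j, h₁, h₂, h₃, h₄, h₅, h₆, rfl⟩ | ⟨ℓ, i, j, -, -, -, -, -, -, -, rfl⟩ |
    ⟨ℓ, k, i, j, -, -, -, -, -, -, -, rfl⟩)
  · rw [ha _ _ (by omega), hrel.a_one_one, ofAdd_zero]
  · rw [hc _ _ (by omega), hrel.c_last_one, ofAdd_zero]
  · rw [map_mul, map_mul, map_mul, map_inv, map_inv, ha _ _ (by omega), hc _ _ (by omega),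
      hrel.a_eq_c ℓ j h₁ h₂ (by omega) h₅, mul_right_comm, mul_inv_cancel_right,
      mul_inv_cancel]
  · rw [map_mul, map_mul, map_mul, map_inv, map_inv, ha _ _ (by omega), hc _ _ (by omega),
      hb _ _ (by omega), hb _ _ (by omega), ← ofAdd_add, hrel.c_add_a ℓ i j h₁ h₂ h₃ h₄ h₅ h₆,
      ofAdd_add, mul_inv_cancel_comm, mul_inv_cancel]
  all_goals
    rw [gcomm, map_mul, map_mul, map_mul, map_inv, map_inv, mul_inv_cancel_comm, mul_inv_cancel]

/-- The homomorphism from the abelianization to the free abelian group given by `genVec`. -/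
noncomputable def toVec (hq : 3 ≤ q) (hp : 3 ≤ p) :
    Additive (Abelianization (B p q)) →+ (BasisIndex p q →₀ ℤ) :=
  MonoidHom.toAdditiveLeft
    (Abelianization.lift (PresentedGroup.toGroup (lift_genVec_eq_one hq hp)))

theorem toVec_wordClass_of (hq : 3 ≤ q) (hp : 3 ≤ p) (x : BGen p q) :
    toVec hq hp (wordClass p q (FreeGroup.of x)) = genVec x :=
  congrArg Multiplicative.toAdd (PresentedGroup.toGroup.of (lift_genVec_eq_one hq hp))

/-- The element of the abelianization represented by a basis index. -/
def basisClass : BasisIndex p q → Additive (Abelianization (B p q))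
  | none => wordClass p q (gc p q 1 1) - wordClass p q (gb p q 1 1)
  | some x => wordClass p q (gb p q x.1.1 x.1.2)

/-- The homomorphism from the free abelian group to the abelianization given by `basisClass`. -/
noncomputable def ofVec (p q : ℕ) :
    (BasisIndex p q →₀ ℤ) →ₗ[ℤ] Additive (Abelianization (B p q)) :=
  Finsupp.linearCombination ℤ basisClass

theorem ofVec_single_none : ofVec p q (Finsupp.single none 1) =
    wordClass p q (gc p q 1 1) - wordClass p q (gb p q 1 1) := by
  simp [ofVec, basisClass]

theorem ofVec_bVec {ℓ i : ℕ} (h : InRange p q ℓ i) :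
    ofVec p q (bVec p q ℓ i) = wordClass p q (gb p q ℓ i) := by
  have hmem : (ℓ, i) ∈ Finset.Icc 1 (q - 1) ×ˢ Finset.Icc 1 (p - 1) := by
    simpa [InRange, and_assoc] using h
  rw [bVec, dif_pos hmem]
  simp [ofVec, basisClass]

theorem ofVec_aVec (hq : 3 ≤ q) (hp : 3 ≤ p) {ℓ i : ℕ} (h : InRange p q ℓ i) :
    ofVec p q (aVec p q ℓ i) = wordClass p q (ga p q ℓ i) := by
  have hrel := abelianRelations_wordClass p q
  obtain ⟨k, rfl⟩ : ∃ k, ℓ = k + 1 := ⟨ℓ - 1, (Nat.sub_add_cancel h.1).symm⟩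
  rw [aVec]
  split_ifs with hone
  · rw [hone.1, hone.2, map_zero, hrel.a_one_one]
  · rw [map_add, map_smul, ofVec_bVec h, ofVec_single_none,
      hrel.a_succ_eq hp hq h.2.1 h.2.2.1 h.2.2.2 (by omega), Nat.add_sub_cancel]

theorem ofVec_cVec (hq : 3 ≤ q) (hp : 3 ≤ p) {ℓ i : ℕ} (h : InRange p q ℓ i) :
    ofVec p q (cVec p q ℓ i) = wordClass p q (gc p q ℓ i) := by
  have hrel := abelianRelations_wordClass p q
  obtain ⟨k, rfl⟩ : ∃ k, ℓ = k + 1 := ⟨ℓ - 1, (Nat.sub_add_cancel h.1).symm⟩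
  rw [cVec]
  split_ifs with hlast
  · rw [hlast.1, hlast.2, map_zero, hrel.c_last_one]
  · rw [map_add, map_smul, ofVec_bVec h, ofVec_single_none,
      hrel.c_succ_eq hp hq h.2.1 h.2.2.1 h.2.2.2 hlast, Nat.add_sub_cancel]

theorem ofVec_genVec (hq : 3 ≤ q) (hp : 3 ≤ p) (x : BGen p q) :
    ofVec p q (genVec x) = wordClass p q (FreeGroup.of x) := by
  obtain ⟨⟨t, ℓ, i⟩, h⟩ := x
  fin_cases t
  · exact (ofVec_aVec hq hp h).trans (congrArg _ (ga_eq_of h))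
  · exact (ofVec_bVec h).trans (congrArg _ (gb_eq_of h))
  · exact (ofVec_cVec hq hp h).trans (congrArg _ (gc_eq_of h))

theorem ofVec_toVec (hq : 3 ≤ q) (hp : 3 ≤ p) (x : Additive (Abelianization (B p q))) :
    ofVec p q (toVec hq hp x) = x := by
  obtain ⟨y, hy⟩ := QuotientGroup.mk_surjective x.toMul
  obtain ⟨w, rfl⟩ := PresentedGroup.mk_surjective _ y
  obtain rfl : wordClass p q w = x := hy
  induction w using FreeGroup.induction_on with
  | C1 => simp [wordClass]
  | of y => rw [toVec_wordClass_of, ofVec_genVec hq hp]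
  | inv_of y ih => rw [wordClass_inv, map_neg, map_neg, ih]
  | mul v w hv hw => rw [wordClass_mul, map_add, map_add, hv, hw]

theorem toVec_wordClass_gb (hq : 3 ≤ q) (hp : 3 ≤ p) {ℓ i : ℕ} (h : InRange p q ℓ i) :
    toVec hq hp (wordClass p q (gb p q ℓ i)) = bVec p q ℓ i := by
  rw [gb_eq_of h, toVec_wordClass_of]
  rfl

theorem toVec_ofVec (hq : 3 ≤ q) (hp : 3 ≤ p) (v : BasisIndex p q →₀ ℤ) :
    toVec hq hp (ofVec p q v) = v := by
  suffices h : (toVec hq hp).toIntLinearMap ∘ₗ ofVec p q = LinearMap.id from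
    LinearMap.congr_fun h v
  refine Finsupp.lhom_ext' fun x ↦ LinearMap.ext_ring ?_
  change toVec hq hp (ofVec p q (Finsupp.single x 1)) = Finsupp.single x 1
  match x with
  | none =>
    have h : InRange p q 1 1 := ⟨le_rfl, by omega, le_rfl, by omega⟩
    rw [ofVec_single_none, map_sub, toVec_wordClass_gb hq hp h, gc_eq_of h, toVec_wordClass_of]
    change cVec p q 1 1 - _ = _
    rw [cVec, if_neg (by omega)]
    simp
  | some ⟨(ℓ, i), hmem⟩ =>
    have h : InRange p q ℓ i := by simpa [InRange, and_assoc] using hmem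
    have hb : bVec p q ℓ i = Finsupp.single (some ⟨(ℓ, i), hmem⟩) 1 := dif_pos hmem
    rw [← hb, ofVec_bVec h, toVec_wordClass_gb hq hp h]

end Presentation

/-- **Theorem (homology in degree 1).**
For all integers `p ≥ q ≥ 3`, the abelianization of `B(p,q)` is free abelian of rank
`(p-1)(q-1) + 1`, i.e. isomorphic to the direct sum of `(p-1)(q-1) + 1` copies of `ℤ`. -/
theorem abelianization_B_free_abelian (p q : ℕ) (hq : 3 ≤ q) (hpq : q ≤ p) :
    Nonempty (Abelianization (B p q) ≃* Multiplicative (Fin ((p - 1) * (q - 1) + 1) → ℤ)) := by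
  have hp : 3 ≤ p := hq.trans hpq
  let e : Additive (Abelianization (B p q)) ≃+ (BasisIndex p q →₀ ℤ) :=
    { toVec hq hp with
      invFun := ofVec p q
      left_inv := ofVec_toVec hq hp
      right_inv := toVec_ofVec hq hp }
  let reindex : (BasisIndex p q →₀ ℤ) ≃ₗ[ℤ] (Fin ((p - 1) * (q - 1) + 1) → ℤ) :=
    Finsupp.linearEquivFunOnFinite ℤ ℤ _ ≪≫ₗ
      LinearEquiv.funCongrLeft ℤ ℤ (Fintype.equivFinOfCardEq (BasisIndex.card p q)).symm
  exact ⟨AddEquiv.toMultiplicativeRight (e.trans reindex.toAddEquiv)⟩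
end

section
/- For all integers p ≥ q ≥ 3, B(p,q) is isomorphic to the group presented by generators a_{ℓ,i} and b_{ℓ,i} for 1 ≤ ℓ ≤ q−1 and 1 ≤ i ≤ p−1, with relators: (i) a_{1,1}; (ii) [a_{ℓ,j}, b_{ℓ,1}⁻¹ b_{ℓ,i}] for 1 ≤ ℓ ≤ q−1 and 2 ≤ i < j ≤ p−1; (iii) b_{ℓ,1} a_{ℓ+1,1}⁻¹ a_{ℓ+1,j} b_{ℓ,1}⁻¹ b_{ℓ+1,j}⁻¹ b_{ℓ+1,1} for 1 ≤ ℓ ≤ q−2 and 2 ≤ j ≤ p−1; (iv) b_{ℓ,1} a_{ℓ,i} b_{ℓ,1}⁻¹ a_{ℓ+1,j} b_{ℓ,i}⁻¹ b_{ℓ+1,j}⁻¹ for 1 ≤ ℓ ≤ q−2, 2 ≤ i ≤ p−1, 1 ≤ j ≤ p−i; (v) [b_{ℓ,1} a_{ℓ,i} b_{ℓ,1}⁻¹, a_{ℓ+1,j}] for 1 ≤ ℓ ≤ q−2 and i,j ∈ {3,…,p−1} with i+j ≥ p+2; (vi) [b_{ℓ+1,1} b_{ℓ,1} a_{ℓ+1,1}⁻¹,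 a_{λ,j}] for 2 ≤ ℓ+1 < λ ≤ q−1 and 1 ≤ j ≤ p−1; (vii) [b_{ℓ,1} a_{ℓ,i} b_{ℓ,1}⁻¹, a_{λ,j}] for 2 ≤ ℓ+1 < λ ≤ q−1, 2 ≤ i ≤ p−1, 1 ≤ j ≤ p−1. Here [x,y] denotes the commutator x y x⁻¹ y⁻¹. -/
/-- Generators of the intermediate presentation: pairs `(t, ℓ, i)` with `t ∈ Fin 2`
(`t = 0` for `a`, `t = 1` for `b`), `1 ≤ ℓ ≤ q - 1`, `1 ≤ i ≤ p - 1`. -/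
def B2Gen (p q : ℕ) : Type :=
  {x : Fin 2 × ℕ × ℕ // 1 ≤ x.2.1 ∧ x.2.1 ≤ q - 1 ∧ 1 ≤ x.2.2 ∧ x.2.2 ≤ p - 1}

/-- The generator `a_{ℓ,i}` of the intermediate presentation, or `1` if out of range. -/
def ha (p q ℓ i : ℕ) : FreeGroup (B2Gen p q) :=
  if h : 1 ≤ ℓ ∧ ℓ ≤ q - 1 ∧ 1 ≤ i ∧ i ≤ p - 1 then FreeGroup.of ⟨(0, ℓ, i), h⟩ else 1

/-- The generator `b_{ℓ,i}` of the intermediate presentation, or `1` if out of range. -/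
def hb (p q ℓ i : ℕ) : FreeGroup (B2Gen p q) :=
  if h : 1 ≤ ℓ ∧ ℓ ≤ q - 1 ∧ 1 ≤ i ∧ i ≤ p - 1 then FreeGroup.of ⟨(1, ℓ, i), h⟩ else 1

/-- The relators (i)–(vii) of the intermediate presentation. -/
def B2rels (p q : ℕ) : Set (FreeGroup (B2Gen p q)) :=
  {r | r = ha p q 1 1
    ∨ (∃ ℓ i j, 1 ≤ ℓ ∧ ℓ ≤ q - 1 ∧ 2 ≤ i ∧ i < j ∧ j ≤ p - 1 ∧
        r = gcomm (ha p q ℓ j) ((hb p q ℓ 1)⁻¹ * hb p q ℓ i))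
    ∨ (∃ ℓ j, 1 ≤ ℓ ∧ ℓ ≤ q - 2 ∧ 2 ≤ j ∧ j ≤ p - 1 ∧
        r = hb p q ℓ 1 * (ha p q (ℓ + 1) 1)⁻¹ * ha p q (ℓ + 1) j * (hb p q ℓ 1)⁻¹ *
            (hb p q (ℓ + 1) j)⁻¹ * hb p q (ℓ + 1) 1)
    ∨ (∃ ℓ i j, 1 ≤ ℓ ∧ ℓ ≤ q - 2 ∧ 2 ≤ i ∧ i ≤ p - 1 ∧ 1 ≤ j ∧ j ≤ p - i ∧
        r = hb p q ℓ 1 * ha p q ℓ i * (hb p q ℓ 1)⁻¹ * ha p q (ℓ + 1) j *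
            (hb p q ℓ i)⁻¹ * (hb p q (ℓ + 1) j)⁻¹)
    ∨ (∃ ℓ i j, 1 ≤ ℓ ∧ ℓ ≤ q - 2 ∧ 3 ≤ i ∧ i ≤ p - 1 ∧ 3 ≤ j ∧ j ≤ p - 1 ∧ p + 2 ≤ i + j ∧
        r = gcomm (hb p q ℓ 1 * ha p q ℓ i * (hb p q ℓ 1)⁻¹) (ha p q (ℓ + 1) j))
    ∨ (∃ ℓ lam j, 2 ≤ ℓ + 1 ∧ ℓ + 1 < lam ∧ lam ≤ q - 1 ∧ 1 ≤ j ∧ j ≤ p - 1 ∧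
        r = gcomm (hb p q (ℓ + 1) 1 * hb p q ℓ 1 * (ha p q (ℓ + 1) 1)⁻¹) (ha p q lam j))
    ∨ (∃ ℓ lam i j, 2 ≤ ℓ + 1 ∧ ℓ + 1 < lam ∧ lam ≤ q - 1 ∧ 2 ≤ i ∧ i ≤ p - 1 ∧
        1 ≤ j ∧ j ≤ p - 1 ∧
        r = gcomm (hb p q ℓ 1 * ha p q ℓ i * (hb p q ℓ 1)⁻¹) (ha p q lam j))}

theorem map_gcomm {G H : Type*} [Group G] [Group H] (f : G →* H) (x y : G) :
    f (gcomm x y) = gcomm (f x) (f y) := by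
  simp [gcomm]

theorem gcomm_inv_mul_eq_one_iff {G : Type*} [Group G] (a x y : G) :
    gcomm a (x⁻¹ * y) = 1 ↔ y * a * y⁻¹ * (x * a * x⁻¹)⁻¹ = 1 := by
  have h : y * a * y⁻¹ * (x * a * x⁻¹)⁻¹ =
      x * (gcomm a (x⁻¹ * y))⁻¹ * x⁻¹ := by
    simp only [gcomm]; group
  rw [h, conj_eq_one_iff, inv_eq_one]

theorem conj_relator_eq_one_iff {G : Type*} [Group G] (x y u v w : G) :
    x * u⁻¹ * v * x⁻¹ * w⁻¹ * y = 1 ↔ y * x * u⁻¹ * v * x⁻¹ * w⁻¹ = 1 := by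
  have h : y * x * u⁻¹ * v * x⁻¹ * w⁻¹ =
      y * (x * u⁻¹ * v * x⁻¹ * w⁻¹ * y) * y⁻¹ := by
    group
  rw [h, conj_eq_one_iff]

namespace BPresentation

variable (p q : ℕ)

/-- The image of `c_{ℓ,i}` in the intermediate presentation. -/
def cWord (ℓ i : ℕ) : FreeGroup (B2Gen p q) :=
  if i = 1 then
    if ℓ = q - 1 then 1 else hb p q (ℓ + 1) 1 * hb p q ℓ 1 * (ha p q (ℓ + 1) 1)⁻¹
  else hb p q ℓ 1 * ha p q ℓ i * (hb p q ℓ 1)⁻¹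

/-- The words replacing the generators of `B(p,q)` when the `c_{ℓ,i}` are eliminated. -/
def elimGen (x : BGen p q) : FreeGroup (B2Gen p q) :=
  if x.1.1 = 0 then ha p q x.1.2.1 x.1.2.2
  else if x.1.1 = 1 then hb p q x.1.2.1 x.1.2.2
  else cWord p q x.1.2.1 x.1.2.2

/-- The inclusion of the generators of the intermediate presentation. -/
def inclGen (x : B2Gen p q) : FreeGroup (BGen p q) :=
  if x.1.1 = 0 then ga p q x.1.2.1 x.1.2.2 else gb p q x.1.2.1 x.1.2.2

/-- Elimination of the `c_{ℓ,i}` on free groups. -/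
def elim : FreeGroup (BGen p q) →* FreeGroup (B2Gen p q) := FreeGroup.lift (elimGen p q)

/-- Inclusion of free groups on the generators. -/
def incl : FreeGroup (B2Gen p q) →* FreeGroup (BGen p q) := FreeGroup.lift (inclGen p q)

variable {p q}

theorem elim_ga (ℓ i : ℕ) : elim p q (ga p q ℓ i) = ha p q ℓ i := by
  by_cases h : 1 ≤ ℓ ∧ ℓ ≤ q - 1 ∧ 1 ≤ i ∧ i ≤ p - 1
  · rw [ga, dif_pos h]; exact FreeGroup.lift_apply_of
  · rw [ga, ha, dif_neg h, dif_neg h, map_one]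

theorem elim_gb (ℓ i : ℕ) : elim p q (gb p q ℓ i) = hb p q ℓ i := by
  by_cases h : 1 ≤ ℓ ∧ ℓ ≤ q - 1 ∧ 1 ≤ i ∧ i ≤ p - 1
  · rw [gb, dif_pos h]; exact FreeGroup.lift_apply_of
  · rw [gb, hb, dif_neg h, dif_neg h, map_one]

theorem elim_gc {ℓ i : ℕ} (h : 1 ≤ ℓ ∧ ℓ ≤ q - 1 ∧ 1 ≤ i ∧ i ≤ p - 1) :
    elim p q (gc p q ℓ i) = cWord p q ℓ i := by
  rw [gc, dif_pos h]; exact FreeGroup.lift_apply_of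

theorem incl_ha (ℓ i : ℕ) : incl p q (ha p q ℓ i) = ga p q ℓ i := by
  by_cases h : 1 ≤ ℓ ∧ ℓ ≤ q - 1 ∧ 1 ≤ i ∧ i ≤ p - 1
  · rw [ha, dif_pos h]; exact FreeGroup.lift_apply_of
  · rw [ha, ga, dif_neg h, dif_neg h, map_one]

theorem incl_hb (ℓ i : ℕ) : incl p q (hb p q ℓ i) = gb p q ℓ i := by
  by_cases h : 1 ≤ ℓ ∧ ℓ ≤ q - 1 ∧ 1 ≤ i ∧ i ≤ p - 1
  · rw [hb, dif_pos h]; exact FreeGroup.lift_apply_of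
  · rw [hb, gb, dif_neg h, dif_neg h, map_one]

theorem cWord_of_two_le {ℓ i : ℕ} (hi : 2 ≤ i) :
    cWord p q ℓ i = hb p q ℓ 1 * ha p q ℓ i * (hb p q ℓ 1)⁻¹ := by
  rw [cWord, if_neg (by omega)]

theorem cWord_one {ℓ : ℕ} (hℓ : ℓ ≠ q - 1) :
    cWord p q ℓ 1 = hb p q (ℓ + 1) 1 * hb p q ℓ 1 * (ha p q (ℓ + 1) 1)⁻¹ := by
  rw [cWord, if_pos rfl, if_neg hℓ]

theorem cWord_last : cWord p q (q - 1) 1 = 1 := by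
  rw [cWord, if_pos rfl, if_pos rfl]

/-- Every relator of `B(p,q)` becomes trivial after eliminating the `c_{ℓ,i}`. -/
theorem mk_elim_eq_one (hq : 3 ≤ q) (hpq : q ≤ p) {r : FreeGroup (BGen p q)}
    (hr : r ∈ Brels p q) : PresentedGroup.mk (B2rels p q) (elim p q r) = 1 := by
  have key : ∀ {s}, s ∈ B2rels p q → PresentedGroup.mk (B2rels p q) s = 1 :=
    PresentedGroup.one_of_mem
  rcases hr with rfl | rfl | ⟨ℓ, i, j, h1, h2, h3, h4, h5, rfl⟩ |
    ⟨ℓ, i, j, h1, h2, h3, h4, h5, h6, rfl⟩ | ⟨ℓ, i, j, h1, h2, h3, h4, h5, h6, h7, rfl⟩ |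
    ⟨ℓ, m, i, j, h1, h2, h3, h4, h5, h6, h7, rfl⟩
  · rw [elim_ga]
    exact key (Or.inl rfl)
  · rw [elim_gc (by omega), cWord_last, map_one]
  · simp only [map_mul, map_inv, elim_ga, elim_gb]
    rw [elim_gc (by omega), cWord_of_two_le (by omega)]
    simp only [map_mul, map_inv]
    rcases Nat.lt_or_ge i 2 with hi | hi
    · obtain rfl : i = 1 := by omega
      exact mul_inv_cancel _
    · rw [← gcomm_inv_mul_eq_one_iff]
      have := key (Or.inr (Or.inl ⟨ℓ, i, j, h1, h2, hi, h4, h5, rfl⟩))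
      simpa only [map_gcomm, map_mul, map_inv] using this
  · simp only [map_mul, map_inv, elim_ga, elim_gb]
    rw [elim_gc (by omega)]
    rcases Nat.lt_or_ge i 2 with hi | hi
    · obtain rfl : i = 1 := by omega
      rw [cWord_one (by omega)]
      rcases Nat.lt_or_ge j 2 with hj | hj
      · obtain rfl : j = 1 := by omega
        simp only [map_mul, map_inv]
        group
      · have := key (Or.inr (Or.inr (Or.inl ⟨ℓ, j, h1, h2, hj, h6, rfl⟩)))
        simp only [map_mul, map_inv] at this ⊢
        exact (conj_relator_eq_one_iff _ _ _ _ _).1 this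
    · rw [cWord_of_two_le hi]
      have := key (Or.inr (Or.inr (Or.inr (Or.inl ⟨ℓ, i, j, h1, h2, hi, h4, h5, h6, rfl⟩))))
      simpa only [map_mul, map_inv] using this
  · rw [map_gcomm, elim_ga, elim_gc (by omega), cWord_of_two_le (by omega)]
    exact key (Or.inr (Or.inr (Or.inr (Or.inr (Or.inl
      ⟨ℓ, i, j, h1, h2, h3, h4, h5, h6, h7, rfl⟩)))))
  · rw [map_gcomm, elim_ga, elim_gc (by omega)]
    rcases Nat.lt_or_ge i 2 with hi | hi
    · obtain rfl : i = 1 := by omega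
      rw [cWord_one (by omega)]
      exact key (Or.inr (Or.inr (Or.inr (Or.inr (Or.inr (Or.inl
        ⟨ℓ, m, j, h1, h2, h3, h6, h7, rfl⟩))))))
    · rw [cWord_of_two_le hi]
      exact key (Or.inr (Or.inr (Or.inr (Or.inr (Or.inr (Or.inr
        ⟨ℓ, m, i, j, h1, h2, h3, hi, h5, h6, h7, rfl⟩))))))

/-- In `B(p,q)`, for `i ≥ 2`, `c_{ℓ,i}` is the conjugate of `a_{ℓ,i}` by `b_{ℓ,1}`. -/
theorem mk_gc_of_two_le {ℓ i : ℕ} (h1 : 1 ≤ ℓ) (h2 : ℓ ≤ q - 1) (hi : 2 ≤ i) (hi' : i ≤ p - 1) :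
    PresentedGroup.mk (Brels p q) (gb p q ℓ 1 * ga p q ℓ i * (gb p q ℓ 1)⁻¹) =
      PresentedGroup.mk (Brels p q) (gc p q ℓ i) := by
  rw [← mul_inv_eq_one, ← map_inv, ← map_mul]
  exact PresentedGroup.one_of_mem
    (Or.inr (Or.inr (Or.inl ⟨ℓ, 1, i, h1, h2, le_rfl, hi, hi', rfl⟩)))

/-- In `B(p,q)`, `c_{ℓ,1}` is expressed through the `a`s and `b`s when `ℓ ≤ q - 2`. -/
theorem mk_gc_one {ℓ : ℕ} (h1 : 1 ≤ ℓ) (h2 : ℓ ≤ q - 2) (hp : 2 ≤ p) :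
    PresentedGroup.mk (Brels p q) (gb p q (ℓ + 1) 1 * gb p q ℓ 1 * (ga p q (ℓ + 1) 1)⁻¹) =
      PresentedGroup.mk (Brels p q) (gc p q ℓ 1) := by
  have h : PresentedGroup.mk (Brels p q) _ = 1 := PresentedGroup.one_of_mem
    (Or.inr (Or.inr (Or.inr (Or.inl
      ⟨ℓ, 1, 1, h1, h2, le_rfl, by omega, le_rfl, by omega, rfl⟩))))
  simp only [map_mul, map_inv] at h ⊢
  rw [mul_inv_eq_one, mul_inv_eq_iff_eq_mul] at h
  rw [← h, mul_inv_cancel_right]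

/-- Every relator of the intermediate presentation is trivial in `B(p,q)`. -/
theorem mk_incl_eq_one (hq : 3 ≤ q) (hpq : q ≤ p) {r : FreeGroup (B2Gen p q)}
    (hr : r ∈ B2rels p q) : PresentedGroup.mk (Brels p q) (incl p q r) = 1 := by
  have key : ∀ {s}, s ∈ Brels p q → PresentedGroup.mk (Brels p q) s = 1 :=
    PresentedGroup.one_of_mem
  rcases hr with rfl | ⟨ℓ, i, j, h1, h2, h3, h4, h5, rfl⟩ | ⟨ℓ, j, h1, h2, h3, h4, rfl⟩ |
    ⟨ℓ, i, j, h1, h2, h3, h4, h5, h6, rfl⟩ | ⟨ℓ, i, j, h1, h2, h3, h4, h5, h6, h7, rfl⟩ |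
    ⟨ℓ, m, j, h1, h2, h3, h4, h5, rfl⟩ | ⟨ℓ, m, i, j, h1, h2, h3, h4, h5, h6, h7, rfl⟩
  · rw [incl_ha]
    exact key (Or.inl rfl)
  · simp only [map_gcomm, map_mul, map_inv, incl_ha, incl_hb]
    rw [gcomm_inv_mul_eq_one_iff]
    have hc := mk_gc_of_two_le (p := p) h1 h2 (by omega : 2 ≤ j) h5
    have := key (Or.inr (Or.inr (Or.inl ⟨ℓ, i, j, h1, h2, by omega, h4, h5, rfl⟩)))
    simp only [map_mul, map_inv] at this hc ⊢
    rwa [hc]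
  · simp only [map_mul, map_inv, incl_ha, incl_hb]
    rw [conj_relator_eq_one_iff]
    have hc := mk_gc_one h1 h2 (by omega : 2 ≤ p)
    have := key (Or.inr (Or.inr (Or.inr (Or.inl
      ⟨ℓ, 1, j, h1, h2, le_rfl, by omega, by omega, h4, rfl⟩))))
    simp only [map_mul, map_inv] at this hc ⊢
    rwa [hc]
  · simp only [map_mul, map_inv, incl_ha, incl_hb]
    have hc := mk_gc_of_two_le (p := p) h1 (by omega : ℓ ≤ q - 1) h3 h4
    have := key (Or.inr (Or.inr (Or.inr (Or.inl
      ⟨ℓ, i, j, h1, h2, by omega, h4, h5, h6, rfl⟩))))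
    simp only [map_mul, map_inv] at this hc ⊢
    rwa [hc]
  · rw [map_gcomm, map_gcomm]
    simp only [map_mul (incl p q), map_inv (incl p q), incl_ha, incl_hb]
    rw [mk_gc_of_two_le h1 (by omega) (by omega) h4, ← map_gcomm]
    exact key (Or.inr (Or.inr (Or.inr (Or.inr (Or.inl
      ⟨ℓ, i, j, h1, h2, h3, h4, h5, h6, h7, rfl⟩)))))
  · rw [map_gcomm, map_gcomm]
    simp only [map_mul (incl p q), map_inv (incl p q), incl_ha, incl_hb]
    rw [mk_gc_one (by omega) (by omega) (by omega), ← map_gcomm]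
    exact key (Or.inr (Or.inr (Or.inr (Or.inr (Or.inr
      ⟨ℓ, m, 1, j, h1, h2, h3, le_rfl, by omega, h4, h5, rfl⟩)))))
  · rw [map_gcomm, map_gcomm]
    simp only [map_mul (incl p q), map_inv (incl p q), incl_ha, incl_hb]
    rw [mk_gc_of_two_le (by omega) (by omega) h4 h5, ← map_gcomm]
    exact key (Or.inr (Or.inr (Or.inr (Or.inr (Or.inr
      ⟨ℓ, m, i, j, h1, h2, h3, by omega, h5, h6, h7, rfl⟩)))))

/-- The words substituted for the `c_{ℓ,i}` represent the `c_{ℓ,i}` in `B(p,q)`. -/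
theorem mk_incl_cWord (hq : 3 ≤ q) (hpq : q ≤ p) {ℓ i : ℕ}
    (h : 1 ≤ ℓ ∧ ℓ ≤ q - 1 ∧ 1 ≤ i ∧ i ≤ p - 1) :
    PresentedGroup.mk (Brels p q) (incl p q (cWord p q ℓ i)) =
      PresentedGroup.mk (Brels p q) (gc p q ℓ i) := by
  rcases Nat.lt_or_ge i 2 with hi | hi
  · obtain rfl : i = 1 := by omega
    by_cases hℓ : ℓ = q - 1
    · subst hℓ
      rw [cWord_last, map_one, map_one]
      exact (PresentedGroup.one_of_mem (Or.inr (Or.inl rfl))).symm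
    · rw [cWord_one hℓ]
      simp only [map_mul (incl p q), map_inv (incl p q), incl_ha, incl_hb]
      exact mk_gc_one h.1 (by omega) (by omega)
  · rw [cWord_of_two_le hi]
    simp only [map_mul (incl p q), map_inv (incl p q), incl_ha, incl_hb]
    exact mk_gc_of_two_le h.1 h.2.1 hi h.2.2.2

theorem mk_incl_elimGen (hq : 3 ≤ q) (hpq : q ≤ p) (x : BGen p q) :
    PresentedGroup.mk (Brels p q) (incl p q (elimGen p q x)) =
      PresentedGroup.mk (Brels p q) (FreeGroup.of x) := by
  obtain ⟨⟨t, ℓ, i⟩, h⟩ := x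
  fin_cases t
  · simp only [elimGen]
    simp [incl_ha, ga, dif_pos h]
  · simp only [elimGen]
    simp [incl_hb, gb, dif_pos h]
  · simp only [elimGen]
    simp [mk_incl_cWord hq hpq h, gc, dif_pos h]

theorem elim_inclGen (x : B2Gen p q) : elim p q (inclGen p q x) = FreeGroup.of x := by
  obtain ⟨⟨t, ℓ, i⟩, h⟩ := x
  fin_cases t
  · simp only [inclGen]
    simp [elim_ga, ha, dif_pos h]
  · simp only [inclGen]
    simp [elim_gb, hb, dif_pos h]

/-- Elimination of the `c_{ℓ,i}` as a homomorphism of presented groups. -/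
def elimHom (hq : 3 ≤ q) (hpq : q ≤ p) : B p q →* PresentedGroup (B2rels p q) :=
  QuotientGroup.map _ _ (elim p q) (Subgroup.normalClosure_le_normal fun _ hr =>
    PresentedGroup.mk_eq_one_iff.1 (mk_elim_eq_one hq hpq hr))

/-- The homomorphism of presented groups sending `a_{ℓ,i}`, `b_{ℓ,i}` to themselves. -/
def inclHom (hq : 3 ≤ q) (hpq : q ≤ p) : PresentedGroup (B2rels p q) →* B p q :=
  QuotientGroup.map _ _ (incl p q) (Subgroup.normalClosure_le_normal fun _ hr =>
    PresentedGroup.mk_eq_one_iff.1 (mk_incl_eq_one hq hpq hr))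

theorem elimHom_of (hq : 3 ≤ q) (hpq : q ≤ p) (x : BGen p q) :
    elimHom hq hpq (PresentedGroup.of x) = PresentedGroup.mk (B2rels p q) (elimGen p q x) :=
  congrArg (PresentedGroup.mk (B2rels p q)) FreeGroup.lift_apply_of

theorem inclHom_of (hq : 3 ≤ q) (hpq : q ≤ p) (x : B2Gen p q) :
    inclHom hq hpq (PresentedGroup.of x) = PresentedGroup.mk (Brels p q) (inclGen p q x) :=
  congrArg (PresentedGroup.mk (Brels p q)) FreeGroup.lift_apply_of

/-- The isomorphism eliminating the generators `c_{ℓ,i}`. -/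
def mulEquiv (hq : 3 ≤ q) (hpq : q ≤ p) : B p q ≃* PresentedGroup (B2rels p q) :=
  MonoidHom.toMulEquiv (elimHom hq hpq) (inclHom hq hpq)
    (PresentedGroup.ext fun x => by
      rw [MonoidHom.comp_apply, elimHom_of]
      exact mk_incl_elimGen hq hpq x)
    (PresentedGroup.ext fun x => by
      rw [MonoidHom.comp_apply, inclHom_of]
      exact congrArg (PresentedGroup.mk (B2rels p q)) (elim_inclGen x))

end BPresentation

/-- **Theorem (first reduction of the presentation).**
For all integers `p ≥ q ≥ 3`, `B(p,q)` is isomorphic to the group presented by generators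
`a_{ℓ,i}`, `b_{ℓ,i}` (`1 ≤ ℓ ≤ q-1`, `1 ≤ i ≤ p-1`) and the relators (i)–(vii). -/
theorem B_iso_intermediate_presentation (p q : ℕ) (hq : 3 ≤ q) (hpq : q ≤ p) :
    Nonempty (B p q ≃* PresentedGroup (B2rels p q)) := by
  exact ⟨BPresentation.mulEquiv hq hpq⟩
end
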